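/- arXiv:2503.14918 — 8 statements merged into one kernel-verified Lean document; each statement's English description precedes it below -/
import Mathlib

section
/- There exist constants c > 0 and C > 0 such that for all integers r and n with 3 ≤ 2r−1 ≤ n ≤ r², the following two statements hold: (i) every n-vertex r-uniform intersecting hypergraph with cover number equal to r has at least 2^(c·r²/n) edges; (ii) there exists an n-vertex r-uniform intersecting hypergraph with cover number equal to r and at most (n/r)^(C·r²/n) edges. In other words, f(n,r) = 2^{Θ̃(r²/n)} in this range. -/
open Finset

/-- The cover number of a hypergraph: the minimum size of a set of vertices
meeting every edge. -/
noncomputable def coverNumber {V : Type*} [DecidableEq V] (H : Finset (Finset V)) : ℕ :=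
  sInf {k | ∃ T : Finset V, T.card = k ∧ ∀ e ∈ H, (e ∩ T).Nonempty}


/-- Existence of an intersecting `r`-uniform hypergraph with cover number at least `r`,
at most `N` vertices and at most `M` edges. -/
def Good (N r M : ℕ) : Prop :=
  ∃ (V : Type) (_ : Fintype V) (_ : DecidableEq V) (H : Finset (Finset V)),
    Fintype.card V ≤ N ∧ H.card ≤ M ∧ (∀ e ∈ H, e.card = r) ∧
    (∀ e ∈ H, ∀ f ∈ H, (e ∩ f).Nonempty) ∧
    ∀ T : Finset V, T.card < r → ∃ e ∈ H, Disjoint e T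

theorem good_one : Good 1 1 1 := by
  refine ⟨Unit, inferInstance, inferInstance, {{()}}, by simp, by simp, by simp, by simp, ?_⟩
  intro T hT
  have : T = ∅ := by
    rw [← Finset.card_eq_zero]; omega
  subst this
  simp

theorem Good.mono {N N' r M M' : ℕ} (h : Good N r M) (hN : N ≤ N') (hM : M ≤ M') :
    Good N' r M' := by
  obtain ⟨V, i1, i2, H, h1, h2, h3⟩ := h
  exact ⟨V, i1, i2, H, h1.trans hN, h2.trans hM, h3⟩

/-- Majority composition. -/
theorem Good.majority {N k M : ℕ} (h : Good N k M) (s : ℕ) (hs : 1 ≤ s) (hk : 1 ≤ k)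
    (hM : 1 ≤ M) :
    Good ((2 * s - 1) * N) (s * k) (4 ^ s * M ^ (2 * s)) := by
  classical
  obtain ⟨V, i1, i2, H, h1, h2, h3, h4, h5⟩ := h
  let I := Fin (2 * s - 1)
  let E : Finset I → (I → Finset V) → Finset (I × V) :=
    fun A g => univ.filter (fun x : I × V => x.1 ∈ A ∧ x.2 ∈ g x.1)
  let HH : Finset (Finset (I × V)) :=
    ((powersetCard s (univ : Finset I)) ×ˢ (Fintype.piFinset (fun _ : I => H))).image
      (fun x => E x.1 x.2)
  refine ⟨I × V, inferInstance, inferInstance, HH, ?_, ?_, ?_, ?_, ?_⟩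
  · rw [Fintype.card_prod, Fintype.card_fin]
    exact Nat.mul_le_mul le_rfl h1
  · refine card_image_le.trans ?_
    rw [card_product, card_powersetCard, Fintype.card_piFinset, card_univ, Fintype.card_fin]
    refine Nat.mul_le_mul ?_ ?_
    · calc (2 * s - 1).choose s ≤ 2 ^ (2 * s - 1) := Nat.choose_le_two_pow _ _
        _ ≤ 2 ^ (2 * s) := Nat.pow_le_pow_right (by norm_num) (by omega)
        _ = 4 ^ s := by rw [pow_mul]; norm_num
    · rw [prod_const, card_univ, Fintype.card_fin]
      calc H.card ^ (2 * s - 1) ≤ M ^ (2 * s - 1) := Nat.pow_le_pow_left h2 _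
        _ ≤ M ^ (2 * s) := Nat.pow_le_pow_right hM (by omega)
  · intro e he
    simp only [HH, mem_image, mem_product, mem_powersetCard, Fintype.mem_piFinset] at he
    obtain ⟨⟨A, g⟩, ⟨⟨-, hA⟩, hg⟩, rfl⟩ := he
    simp only at hA hg
    have : E A g = (A.sigma (fun i => g i)).image (fun x => (x.1, x.2)) := by
      ext ⟨i, v⟩
      simp [E]
    show (E A g).card = _
    rw [this, card_image_of_injective, card_sigma, sum_congr rfl (fun i _ => h3 _ (hg i)),
      sum_const, hA, smul_eq_mul]
    rintro ⟨a, b⟩ ⟨c, d⟩ h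
    simp at h
    simp [h.1, h.2]
  · intro e he f hf
    simp only [HH, mem_image, mem_product, mem_powersetCard, Fintype.mem_piFinset] at he hf
    obtain ⟨⟨A, g⟩, ⟨⟨-, hA⟩, hg⟩, rfl⟩ := he
    obtain ⟨⟨A', g'⟩, ⟨⟨-, hA'⟩, hg'⟩, rfl⟩ := hf
    simp only at hA hg hA' hg'
    have hne : (A ∩ A').Nonempty := by
      rw [← card_pos]
      have h1 := card_union_add_card_inter A A'
      have h2 := card_le_univ (A ∪ A')
      rw [Fintype.card_fin] at h2
      omega
    obtain ⟨i, hi⟩ := hne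
    obtain ⟨v, hv⟩ := h4 _ (hg i) _ (hg' i)
    rw [mem_inter] at hi hv
    exact ⟨(i, v), by simp [E, hi.1, hi.2, hv.1, hv.2]⟩
  · intro T hT
    let Ti : I → Finset V := fun i => univ.filter (fun v => (i, v) ∈ T)
    let bad : Finset I := univ.filter (fun i => k ≤ (Ti i).card)
    have hsum : ∑ i ∈ bad, (Ti i).card ≤ T.card := by
      rw [← card_sigma]
      refine card_le_card_of_injOn (fun x => (x.1, x.2)) ?_ ?_
      · rintro ⟨i, v⟩ hx
        simp [Ti] at hx
        simpa using hx.2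
      · rintro ⟨a, b⟩ _ ⟨c, d⟩ _ h
        simp at h
        simp [h.1, h.2]
    have hbad : bad.card < s := by
      by_contra hcon
      push Not at hcon
      have : bad.card * k ≤ ∑ i ∈ bad, (Ti i).card := by
        rw [← smul_eq_mul]
        exact card_nsmul_le_sum _ _ _ (fun i hi => by simpa [bad] using hi)
      have := Nat.mul_le_mul_right k hcon
      omega
    have hgood : s ≤ (badᶜ).card := by
      rw [card_compl, Fintype.card_fin]; omega
    obtain ⟨A, hAs, hA⟩ := exists_subset_card_eq hgood
    have hex : ∀ i : I, ∃ e ∈ H, i ∈ A → Disjoint e (Ti i) := by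
      intro i
      by_cases hi : i ∈ A
      · have : i ∉ bad := by simpa using hAs hi
        have h' : (Ti i).card < k := by simpa [bad] using this
        obtain ⟨e, he, hd⟩ := h5 _ h'
        exact ⟨e, he, fun _ => hd⟩
      · obtain ⟨e, he, hd⟩ := h5 ∅ (by rw [card_empty]; omega)
        exact ⟨e, he, fun h => absurd h hi⟩
    choose g hg hgd using hex
    refine ⟨E A g, ?_, ?_⟩
    · simp only [HH, mem_image, mem_product, mem_powersetCard, Fintype.mem_piFinset]
      exact ⟨(A, g), ⟨⟨subset_univ _, hA⟩, hg⟩, rfl⟩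
    · rw [disjoint_left]
      rintro ⟨i, v⟩ hx hT'
      simp only [E, mem_filter, mem_univ, true_and] at hx
      exact (disjoint_left.mp (hgd i hx.1)) hx.2 (by simp [Ti, hT'])

/-- representatives of the projective line over `ZMod t` -/
theorem exists_reps (t : ℕ) [NeZero t] :
    ∃ S : Finset (ZMod t × ZMod t), S.card * Nat.totient t ≤ t ^ 2 ∧
      (2 ≤ t → S.card * Nat.totient t + 1 ≤ t ^ 2) ∧
      (∀ p ∈ S, ∃ u v, u * p.1 + v * p.2 = 1) ∧
      ∀ c d, ∃ p ∈ S, c * p.1 + d * p.2 = 0 := by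
  classical
  let rep : ZMod t × ZMod t → ZMod t × ZMod t := fun p =>
    (Quotient.mk (MulAction.orbitRel (ZMod t)ˣ (ZMod t × ZMod t)) p).out
  have hrep : ∀ p, ∃ w : (ZMod t)ˣ, w • p = rep p := by
    intro p
    have := Quotient.mk_out (s := MulAction.orbitRel (ZMod t)ˣ (ZMod t × ZMod t)) p
    rw [MulAction.orbitRel_apply] at this
    exact this
  have hrep2 : ∀ p (w : (ZMod t)ˣ), rep (w • p) = rep p := by
    intro p w
    simp only [rep]
    congr 1
    rw [Quotient.eq, MulAction.orbitRel_apply]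
    exact ⟨w, rfl⟩
  have hrep3 : ∀ p, rep (rep p) = rep p := by
    intro p
    obtain ⟨w, hw⟩ := hrep p
    rw [← hw, hrep2, hw]
  let U : Finset (ZMod t × ZMod t) := univ.filter (fun p => ∃ u v, u * p.1 + v * p.2 = 1)
  have hU : ∀ p (w : (ZMod t)ˣ), p ∈ U → w • p ∈ U := by
    intro p w hp
    simp only [U, mem_filter, mem_univ, true_and] at hp ⊢
    obtain ⟨u, v, h⟩ := hp
    refine ⟨u * ↑w⁻¹, v * ↑w⁻¹, ?_⟩
    simp only [Prod.smul_fst, Prod.smul_snd, Units.smul_def, smul_eq_mul]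
    linear_combination h + (u * p.1 + v * p.2) * (Units.inv_mul w)
  let S := U.image rep
  have hSU : ∀ p ∈ S, p ∈ U := by
    intro p hp
    simp only [S, mem_image] at hp
    obtain ⟨a, ha, rfl⟩ := hp
    obtain ⟨w, hw⟩ := hrep a
    rw [← hw]; exact hU _ _ ha
  have hcard : S.card * Nat.totient t ≤ U.card := by
    rw [← ZMod.card_units_eq_totient, ← card_univ, ← card_product]
    refine card_le_card_of_injOn (fun x => x.2 • x.1) ?_ ?_
    · rintro ⟨p, w⟩ hx
      simp at hx
      exact hU _ _ (hSU _ hx)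
    · rintro ⟨p, w⟩ hx ⟨p', w'⟩ hx' h
      simp at hx hx' h
      have hp : rep p = p := by
        simp only [S, mem_image] at hx
        obtain ⟨a, ha, rfl⟩ := hx
        exact hrep3 a
      have hp' : rep p' = p' := by
        simp only [S, mem_image] at hx'
        obtain ⟨a, ha, rfl⟩ := hx'
        exact hrep3 a
      have : p = p' := by
        rw [← hp, ← hp', ← hrep2 p w, h, hrep2]
      subst this
      have hpU := hSU _ hx
      simp only [U, mem_filter, mem_univ, true_and] at hpU
      obtain ⟨u, v, huv⟩ := hpU
      have e1 := congrArg Prod.fst h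
      have e2 := congrArg Prod.snd h
      simp only [Prod.smul_fst, Prod.smul_snd, Units.smul_def, smul_eq_mul] at e1 e2
      have : (w : ZMod t) = w' := by
        linear_combination u * e1 + v * e2 - (w - w' : ZMod t) * huv
      rw [Units.ext this]
  have htot : Fintype.card (ZMod t × ZMod t) = t ^ 2 := by
    rw [Fintype.card_prod, ZMod.card]; ring
  refine ⟨S, ?_, ?_, ?_, ?_⟩
  · exact hcard.trans (htot ▸ card_le_univ U)
  · intro ht
    have : U.card < t ^ 2 := by
      rw [← htot]
      apply card_lt_univ_of_notMem (x := (0, 0))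
      have : Fact (1 < t) := ⟨by omega⟩
      simp [U]
    omega
  · intro p hp
    have := hSU p hp
    simpa [U] using this
  · intro c d
    have key : ∃ p ∈ U, c * p.1 + d * p.2 = 0 := by
      by_cases h0 : Int.gcd (c.val : ℤ) (d.val : ℤ) = 0
      · rw [Int.gcd_eq_zero_iff] at h0
        have hc : c = 0 := by rw [← ZMod.val_eq_zero]; exact_mod_cast h0.1
        have hd : d = 0 := by rw [← ZMod.val_eq_zero]; exact_mod_cast h0.2
        refine ⟨(1, 0), ?_, by simp [hc, hd]⟩
        simp only [U, mem_filter, mem_univ, true_and]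
        exact ⟨1, 0, by simp⟩
      · obtain ⟨g, c', d', hg, hco, hc, hd⟩ := Int.exists_gcd_one' (Nat.pos_of_ne_zero h0)
        have hb := Int.isCoprime_iff_gcd_eq_one.mpr hco
        obtain ⟨u, v, huv⟩ := hb
        have hc1 : c = (c' : ZMod t) * (g : ZMod t) := by
          have := congrArg (Int.cast : ℤ → ZMod t) hc
          simpa using this
        have hd1 : d = (d' : ZMod t) * (g : ZMod t) := by
          have := congrArg (Int.cast : ℤ → ZMod t) hd
          simpa using this
        have h1 := congrArg (Int.cast : ℤ → ZMod t) huv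
        push_cast at h1
        refine ⟨((d' : ZMod t), -(c' : ZMod t)), ?_, ?_⟩
        · simp only [U, mem_filter, mem_univ, true_and]
          exact ⟨v, -u, by linear_combination h1⟩
        · simp only
          rw [hc1, hd1]; ring
    obtain ⟨p, hp, h⟩ := key
    refine ⟨rep p, mem_image_of_mem _ hp, ?_⟩
    obtain ⟨w, hw⟩ := hrep p
    rw [← hw]
    simp only [Prod.smul_fst, Prod.smul_snd, Units.smul_def, smul_eq_mul]
    linear_combination (w : ZMod t) * h
/-- Adding `t` to the uniformity. -/
theorem Good.add {N r₀ M : ℕ} (h : Good N r₀ M) (t : ℕ) (ht : 1 ≤ t)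
    (S : Finset (ZMod t × ZMod t)) (hS : S.card ≤ r₀ + t)
    (hS1 : ∀ p ∈ S, ∃ u v, u * p.1 + v * p.2 = 1)
    (hS2 : ∀ c d, ∃ p ∈ S, c * p.1 + d * p.2 = 0) :
    Good (N + (r₀ + t) * t) (r₀ + t) ((r₀ + t) * M + t ^ 2) := by
  classical
  have : NeZero t := ⟨by omega⟩
  obtain ⟨V, i1, i2, H, h1, h2, h3, h4, h5⟩ := h
  obtain ⟨r, hr⟩ : ∃ r, r = r₀ + t := ⟨_, rfl⟩
  rw [← hr] at hS ⊢
  -- surjection from coordinates onto S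
  obtain ⟨σ, hσ, hσs⟩ : ∃ σ : Fin r → ZMod t × ZMod t, (∀ j, σ j ∈ S) ∧
      ∀ p ∈ S, ∃ j, σ j = p := by
    obtain ⟨p0, hp0, -⟩ := hS2 0 0
    have : Nonempty S := ⟨⟨p0, hp0⟩⟩
    have : Fintype.card S ≤ Fintype.card (Fin r) := by simpa using hS
    obtain ⟨f⟩ := Function.Embedding.nonempty_of_card_le this
    refine ⟨fun j => (Function.invFun f j : S), fun j => (Function.invFun f j).2, ?_⟩
    intro p hp
    exact ⟨f ⟨p, hp⟩, by simp only [Function.leftInverse_invFun f.injective ⟨p, hp⟩]⟩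
  let φ : ZMod t × ZMod t → Fin r → ZMod t := fun a j => a.1 * (σ j).1 + a.2 * (σ j).2
  let B : ZMod t × ZMod t → Finset (V ⊕ (Fin r × ZMod t)) := fun a =>
    univ.image (fun j => Sum.inr (j, φ a j))
  let P : Finset V × Fin r → Finset (V ⊕ (Fin r × ZMod t)) := fun x =>
    x.1.disjSum (univ.image (fun v => (x.2, v)))
  let HH := ((H ×ˢ univ).image P) ∪ univ.image B
  have memB : ∀ a x, x ∈ B a ↔ ∃ j, Sum.inr (j, φ a j) = x := by
    intro a x; simp [B]
  have memP : ∀ e j k v, (Sum.inr (k, v) : V ⊕ (Fin r × ZMod t)) ∈ P (e, j) ↔ k = j := by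
    intro e j k v
    simp [P, eq_comm]
  have memP' : ∀ e j v, (Sum.inl v : V ⊕ (Fin r × ZMod t)) ∈ P (e, j) ↔ v ∈ e := by
    intro e j v
    simp [P]
  refine ⟨V ⊕ (Fin r × ZMod t), inferInstance, inferInstance, HH, ?_, ?_, ?_, ?_, ?_⟩
  · rw [Fintype.card_sum, Fintype.card_prod, Fintype.card_fin, ZMod.card]; omega
  · refine (card_union_le _ _).trans (Nat.add_le_add ?_ ?_)
    · refine card_image_le.trans ?_
      rw [card_product, card_univ, Fintype.card_fin, mul_comm]
      exact Nat.mul_le_mul_left _ h2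
    · refine card_image_le.trans ?_
      rw [card_univ, Fintype.card_prod, ZMod.card]; exact (sq t).ge
  · intro e he
    simp only [HH, mem_union, mem_image, mem_product, mem_univ, and_true, true_and] at he
    rcases he with ⟨⟨e, j⟩, he, rfl⟩ | ⟨a, rfl⟩
    · simp only [P]
      rw [card_disjSum, card_image_of_injective, card_univ, ZMod.card, h3 _ he, hr]
      intro a b hab
      simpa using hab
    · simp only [B]
      rw [card_image_of_injective, card_univ, Fintype.card_fin]
      intro a b hab
      simp at hab
      exact hab.1
  · have hPB : ∀ x a, (P x ∩ B a).Nonempty := by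
      rintro ⟨e, j⟩ a
      refine ⟨Sum.inr (j, φ a j), ?_⟩
      rw [mem_inter, memP, memB]
      exact ⟨rfl, j, rfl⟩
    intro e he f hf
    simp only [HH, mem_union, mem_image, mem_product, mem_univ, and_true, true_and] at he hf
    rcases he with ⟨⟨e, j⟩, he, rfl⟩ | ⟨a, rfl⟩ <;> rcases hf with ⟨⟨f, k⟩, hf, rfl⟩ | ⟨b, rfl⟩
    · obtain ⟨v, hv⟩ := h4 e he f hf
      rw [mem_inter] at hv
      exact ⟨Sum.inl v, by rw [mem_inter, memP', memP']; exact hv⟩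
    · exact hPB _ _
    · rw [inter_comm]; exact hPB _ _
    · obtain ⟨p, hp, hpe⟩ := hS2 (a.1 - b.1) (a.2 - b.2)
      obtain ⟨j, rfl⟩ := hσs p hp
      refine ⟨Sum.inr (j, φ a j), ?_⟩
      rw [mem_inter, memB, memB]
      refine ⟨⟨j, rfl⟩, j, ?_⟩
      have : φ b j = φ a j := by
        simp only [φ]
        linear_combination -hpe
      rw [this]
  · intro T hT
    let T1 := T.toLeft
    let T2 := T.toRight
    have hT12 : T1.card + T2.card = T.card := card_toLeft_add_card_toRight
    by_cases hc : T1.card < r₀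
    · obtain ⟨e, he, hd⟩ := h5 T1 hc
      have hj : ∃ j : Fin r, ∀ v, (j, v) ∉ T2 := by
        by_contra hcon
        push Not at hcon
        have : (univ : Finset (Fin r)) ⊆ T2.image Prod.fst := by
          intro j _
          obtain ⟨v, hv⟩ := hcon j
          exact mem_image.mpr ⟨_, hv, rfl⟩
        have := (card_le_card this).trans card_image_le
        rw [card_univ, Fintype.card_fin] at this
        omega
      obtain ⟨j, hj⟩ := hj
      refine ⟨P (e, j), ?_, ?_⟩
      · simp only [HH, mem_union]
        left
        exact mem_image_of_mem _ (by simp [he])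
      · rw [disjoint_left]
        rintro (v | ⟨k, v⟩) hx hxT
        · rw [memP'] at hx
          exact disjoint_left.mp hd hx (by simpa [T1] using hxT)
        · rw [memP] at hx
          subst hx
          exact hj v (by simpa [T2] using hxT)
    · have hT2 : T2.card < t := by omega
      have hfib : ∀ y : Fin r × ZMod t, (univ.filter (fun a => φ a y.1 = y.2)).card ≤ t := by
        rintro ⟨j, w⟩
        obtain ⟨u, v, huv⟩ := hS1 _ (hσ j)
        have : (univ : Finset (ZMod t)).card = t := by rw [card_univ, ZMod.card]
        refine le_trans ?_ this.le
        refine card_le_card_of_injOn (fun a => a.2 * u - a.1 * v) (fun _ _ => mem_coe.mpr (mem_univ _)) ?_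
        rintro ⟨a, b⟩ ha ⟨a', b'⟩ ha' hab
        simp [φ] at ha ha' hab
        ext
        · simp only
          linear_combination (-(a - a')) * huv + u * (ha - ha') - (σ j).2 * hab
        · simp only
          linear_combination (-(b - b')) * huv + v * (ha - ha') + (σ j).1 * hab
      have hex : ∃ a, ∀ y ∈ T2, φ a y.1 ≠ y.2 := by
        by_contra hcon
        push Not at hcon
        have hsub : (univ : Finset (ZMod t × ZMod t)) ⊆
            T2.biUnion (fun y => univ.filter (fun a => φ a y.1 = y.2)) := by
          intro a _
          obtain ⟨y, hy, hy'⟩ := hcon a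
          simp only [mem_biUnion, mem_filter, mem_univ, true_and]
          exact ⟨y, hy, hy'⟩
        have h1 := (card_le_card hsub).trans (card_biUnion_le_card_mul _ _ t (fun y _ => hfib y))
        rw [card_univ, Fintype.card_prod, ZMod.card] at h1
        exact absurd (Nat.le_of_mul_le_mul_right h1 (by omega)) (by omega)
      obtain ⟨a, ha⟩ := hex
      refine ⟨B a, ?_, ?_⟩
      · simp only [HH, mem_union]
        right
        exact mem_image_of_mem _ (mem_univ _)
      · rw [disjoint_left]
        intro x hx hxT
        rw [memB] at hx
        obtain ⟨j, rfl⟩ := hx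
        exact ha (j, φ a j) (by simpa [T2] using hxT) rfl

theorem Good.add' {N r₀ M : ℕ} (h : Good N r₀ M) (t : ℕ)
    (hS : t ^ 2 ≤ (r₀ + t) * Nat.totient t) :
    Good (N + (r₀ + t) * t) (r₀ + t) ((r₀ + t) * M + M + t ^ 2) := by
  rcases Nat.eq_zero_or_pos t with rfl | ht
  · exact h.mono (by simp) (by simp)
  · have : NeZero t := ⟨by omega⟩
    obtain ⟨S, h1, -, h3, h4⟩ := exists_reps t
    have := Nat.le_of_mul_le_mul_right (h1.trans hS) (Nat.totient_pos.mpr ht)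
    exact (h.add t ht S this h3 h4).mono le_rfl (by omega)

theorem good_plane (p : ℕ) (hp : p.Prime) : Good (p ^ 2 + p + 1) (p + 1) (p ^ 2 + p + 1) := by
  have hp2 := hp.two_le
  have : NeZero p := ⟨by omega⟩
  obtain ⟨S, -, h2, h3, h4⟩ := exists_reps p
  have h2 := h2 hp2
  rw [Nat.totient_prime hp] at h2
  have hS : S.card ≤ 1 + p := by
    obtain ⟨k, rfl⟩ : ∃ k, p = k + 2 := ⟨p - 2, by omega⟩
    simp only [show k + 2 - 1 = k + 1 by omega] at h2
    nlinarith
  have := good_one.add p (by omega) S hS h3 h4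
  rw [add_comm 1 p] at this
  exact this.mono (by ring_nf; rfl) (by ring_nf; rfl)

theorem totient_ge (y t : ℕ) (hy : 255 ≤ y) (ht : 1 ≤ t) (hty : t < 16 ^ (y + 1))
    (hco : ∀ p, p.Prime → p ∣ t → y < p) : t ≤ 2 * Nat.totient t := by
  have hω : t.primeFactors.card * 2 ≤ y + 1 := by
    have h1 : (y + 1) ^ t.primeFactors.card ≤ t := by
      calc (y + 1) ^ t.primeFactors.card ≤ ∏ p ∈ t.primeFactors, p := by
            apply Finset.pow_card_le_prod
            intro p hp
            exact hco p (Nat.prime_of_mem_primeFactors hp) (Nat.dvd_of_mem_primeFactors hp)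
        _ ≤ t := Nat.le_of_dvd ht (Nat.prod_primeFactors_dvd t)
    have h2 : (2:ℕ) ^ (8 * t.primeFactors.card) < 2 ^ (4 * (y + 1)) := by
      calc (2:ℕ) ^ (8 * t.primeFactors.card) = 256 ^ t.primeFactors.card := by
            rw [pow_mul]; norm_num
        _ ≤ (y + 1) ^ t.primeFactors.card := Nat.pow_le_pow_left (by omega) _
        _ ≤ t := h1
        _ < 16 ^ (y + 1) := hty
        _ = 2 ^ (4 * (y + 1)) := by rw [pow_mul]; norm_num
    have := (Nat.pow_lt_pow_iff_right (by norm_num : 1 < 2)).mp h2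
    omega
  have h := Nat.totient_eq_mul_prod_factors t
  have hb : (1 / 2 : ℚ) ≤ ∏ p ∈ t.primeFactors, (1 - (p : ℚ)⁻¹) := by
    have hy1 : (0:ℚ) < (y:ℚ) + 1 := by positivity
    calc (1 / 2 : ℚ) ≤ 1 + (t.primeFactors.card : ℚ) * (-((y:ℚ) + 1)⁻¹) := by
          have : (t.primeFactors.card : ℚ) * 2 ≤ (y:ℚ) + 1 := by exact_mod_cast hω
          have h3 : (t.primeFactors.card : ℚ) * ((y:ℚ) + 1)⁻¹ ≤ 1 / 2 := by
            rw [← div_eq_mul_inv, div_le_iff₀ hy1]; linarith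
          linarith
      _ ≤ (1 + (-((y:ℚ) + 1)⁻¹)) ^ t.primeFactors.card := by
          apply one_add_mul_le_pow
          have : ((y:ℚ) + 1)⁻¹ ≤ 1 := inv_le_one_of_one_le₀ (by linarith [(Nat.cast_nonneg y : (0:ℚ) ≤ y)])
          linarith
      _ = ∏ p ∈ t.primeFactors, (1 + (-((y:ℚ) + 1)⁻¹)) := by rw [prod_const]
      _ ≤ _ := by
          apply prod_le_prod
          · intro p _
            have : ((y:ℚ) + 1)⁻¹ ≤ 1 := inv_le_one_of_one_le₀ (by linarith [(Nat.cast_nonneg y : (0:ℚ) ≤ y)])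
            linarith
          · intro p hp
            have h4 := hco p (Nat.prime_of_mem_primeFactors hp) (Nat.dvd_of_mem_primeFactors hp)
            have h5 : (y:ℚ) + 1 ≤ p := by exact_mod_cast h4
            have := inv_anti₀ hy1 h5
            linarith
  have h6 : (t:ℚ) ≤ 2 * (Nat.totient t : ℚ) := by
    rw [h]
    have : (0:ℚ) ≤ t := Nat.cast_nonneg t
    nlinarith
  exact_mod_cast h6

/-- Any remainder `ρ < r₀` can be added. -/
theorem Good.add_rem {N r₀ M : ℕ} (h : Good N r₀ M) (ρ : ℕ) (hρ : ρ ≤ r₀)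
    (hM : 1 ≤ M) (hr : 16 ^ 255 ≤ r₀ + ρ) :
    Good (N + (r₀ + ρ) * ρ) (r₀ + ρ) (16 * (r₀ + ρ) ^ 4 * M) := by
  obtain ⟨R, hR⟩ : ∃ R, R = r₀ + ρ := ⟨_, rfl⟩
  have hR0 : 1 ≤ R := by rw [hR]; exact le_trans Nat.one_le_two_pow (le_trans (Nat.pow_le_pow_left (by norm_num) 255) hr)
  rcases Nat.eq_zero_or_pos ρ with rfl | hρ0
  · refine h.mono (by simp) ?_
    rw [← hR]
    have : 1 ≤ R ^ 4 := Nat.one_le_pow _ _ hR0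
    nlinarith
  let y := Nat.log 16 R
  have hy1 : 16 ^ y ≤ R := Nat.pow_log_le_self 16 (by omega)
  have hy2 : R < 16 ^ (y + 1) := Nat.lt_pow_succ_log_self (by norm_num) R
  have hy3 : 255 ≤ y := (Nat.le_log_iff_pow_le (by norm_num) (by omega)).mpr (hR ▸ hr)
  let d := primorial y
  have hd0 : 0 < d := primorial_pos y
  have hd : d ^ 2 ≤ R := by
    calc d ^ 2 ≤ (4 ^ y) ^ 2 := Nat.pow_le_pow_left (primorial_le_four_pow y) 2
      _ = 16 ^ y := by rw [← pow_mul, mul_comm, pow_mul]; norm_num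
      _ ≤ R := hy1
  let t₁ := 1 + d * ((ρ - 1) / d)
  let t₂ := (ρ - 1) % d
  have ht : t₁ + t₂ = ρ := by
    have := Nat.div_add_mod (ρ - 1) d
    simp only [t₁, t₂]; omega
  have ht2 : t₂ < d := Nat.mod_lt _ hd0
  have htot : t₁ ≤ 2 * Nat.totient t₁ := by
    apply totient_ge y t₁ hy3 (by simp [t₁]) (by omega)
    intro p hp hpt
    by_contra hcon
    push Not at hcon
    have hpd : p ∣ d := by
      apply Finset.dvd_prod_of_mem
      simp [hp]; omega
    have : p ∣ 1 := (Nat.dvd_add_left (hpd.mul_right _)).mp hpt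
    exact hp.one_lt.ne' (Nat.dvd_one.mp this)
  have g1 := h.add' t₁ (by
    have : 2 * t₁ ≤ r₀ + t₁ := by omega
    nlinarith)
  have g2 := g1.add' t₂ (by
    rcases Nat.eq_zero_or_pos t₂ with h0 | h0
    · simp [h0]
    · have h1 : 1 ≤ Nat.totient t₂ := Nat.totient_pos.mpr h0
      have h2 : t₂ ^ 2 ≤ R := (Nat.pow_le_pow_left ht2.le 2).trans hd
      have h3 : r₀ + t₁ + t₂ = R := by omega
      rw [h3]
      nlinarith)
  rw [show r₀ + t₁ + t₂ = R by omega] at g2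
  rw [← hR]
  refine g2.mono ?_ ?_
  · have : (r₀ + t₁) * t₁ ≤ R * t₁ := Nat.mul_le_mul_right _ (by omega)
    have h' : R * ρ = R * t₁ + R * t₂ := by rw [← mul_add, ht]
    linarith
  · have e1 : (r₀ + t₁) * M + M + t₁ ^ 2 ≤ 3 * R ^ 2 * M := by
      have a1 : (r₀ + t₁) * M ≤ R * M := Nat.mul_le_mul_right _ (by omega)
      have a2 : R * M ≤ R ^ 2 * M := Nat.mul_le_mul_right _ (by nlinarith)
      have a3 : M ≤ R ^ 2 * M := Nat.le_mul_of_pos_left _ (by positivity)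
      have a4 : t₁ ^ 2 ≤ R ^ 2 := Nat.pow_le_pow_left (by omega) _
      have a5 : R ^ 2 ≤ R ^ 2 * M := Nat.le_mul_of_pos_right _ (by omega)
      linarith
    obtain ⟨Q, hQ⟩ : ∃ Q, Q = (r₀ + t₁) * M + M + t₁ ^ 2 := ⟨_, rfl⟩
    rw [← hQ] at e1 ⊢
    have b1 : R * Q ≤ R * (3 * R ^ 2 * M) := Nat.mul_le_mul_left _ e1
    have b2 : t₂ ^ 2 ≤ R ^ 2 := Nat.pow_le_pow_left (by omega) _
    have c3 : R ^ 2 ≤ R ^ 4 := Nat.pow_le_pow_right hR0 (by norm_num)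
    have c4 : R ^ 3 ≤ R ^ 4 := Nat.pow_le_pow_right hR0 (by norm_num)
    have d3 : R ^ 2 * M ≤ R ^ 4 * M := Nat.mul_le_mul_right _ c3
    have d4 : R ^ 3 * M ≤ R ^ 4 * M := Nat.mul_le_mul_right _ c4
    have d5 : R ^ 2 ≤ R ^ 2 * M := Nat.le_mul_of_pos_right _ (by omega)
    have b3 : R * (3 * R ^ 2 * M) = 3 * (R ^ 3 * M) := by ring
    nlinarith

theorem coverNumber_eq {V : Type*} [DecidableEq V] (H : Finset (Finset V)) (r : ℕ) (hr : 1 ≤ r)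
    (h3 : ∀ e ∈ H, e.card = r) (h4 : ∀ e ∈ H, ∀ f ∈ H, (e ∩ f).Nonempty)
    (h5 : ∀ T : Finset V, T.card < r → ∃ e ∈ H, Disjoint e T) : coverNumber H = r := by
  obtain ⟨e, he, -⟩ := h5 ∅ (by rw [card_empty]; omega)
  have hmem : r ∈ {k | ∃ T : Finset V, T.card = k ∧ ∀ e ∈ H, (e ∩ T).Nonempty} :=
    ⟨e, h3 e he, fun f hf => h4 f hf e he⟩
  apply le_antisymm
  · exact Nat.sInf_le hmem
  · apply le_csInf ⟨r, hmem⟩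
    rintro k ⟨T, rfl, hT⟩
    by_contra hcon
    push Not at hcon
    obtain ⟨f, hf, hd⟩ := h5 T hcon
    exact (hT f hf).ne_empty (disjoint_iff_inter_eq_empty.mp hd)

theorem Good.toFin {N r M n : ℕ} (h : Good N r M) (hr : 1 ≤ r) (hn : N ≤ n) :
    ∃ H : Finset (Finset (Fin n)),
      (∀ e ∈ H, e.card = r) ∧ (∀ e ∈ H, ∀ f ∈ H, (e ∩ f).Nonempty) ∧
      coverNumber H = r ∧ H.card ≤ M := by
  classical
  obtain ⟨V, i1, i2, H, h1, h2, h3, h4, h5⟩ := h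
  have : Fintype.card V ≤ Fintype.card (Fin n) := by rw [Fintype.card_fin]; omega
  obtain ⟨φ⟩ := Function.Embedding.nonempty_of_card_le this
  let H' := H.image (fun e => e.map φ)
  have a3 : ∀ e ∈ H', e.card = r := by
    intro e' he'
    obtain ⟨e, he, rfl⟩ := mem_image.mp he'
    rw [card_map, h3 e he]
  have a4 : ∀ e ∈ H', ∀ f ∈ H', (e ∩ f).Nonempty := by
    intro e' he' f' hf'
    obtain ⟨e, he, rfl⟩ := mem_image.mp he'
    obtain ⟨f, hf, rfl⟩ := mem_image.mp hf'
    rw [← map_inter]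
    exact (h4 e he f hf).map
  refine ⟨H', a3, a4, coverNumber_eq H' r hr a3 a4 ?_, card_image_le.trans h2⟩
  intro T hT
  let T' : Finset V := univ.filter (fun v => φ v ∈ T)
  have hT' : T'.card < r := by
    refine lt_of_le_of_lt ?_ hT
    refine card_le_card_of_injOn φ ?_ φ.injective.injOn
    intro v hv
    simpa [T'] using hv
  obtain ⟨e, he, hd⟩ := h5 T' hT'
  refine ⟨e.map φ, mem_image_of_mem _ he, ?_⟩
  rw [disjoint_left]
  intro x hx hxT
  obtain ⟨v, hv, rfl⟩ := mem_map.mp hx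
  exact disjoint_left.mp hd hv (by simp [T', hxT])

/-- Greedy cover. -/
theorem greedy {V : Type} [Fintype V] [DecidableEq V] (H : Finset (Finset V)) (r : ℕ)
    (hH : ∀ e ∈ H, e.card = r) (hV : 0 < Fintype.card V)
    (hr : r ≤ Fintype.card V) (k : ℕ) :
    ∃ T : Finset V, T.card ≤ k ∧
      ((H.filter (fun e => Disjoint e T)).card : ℝ) ≤
        H.card * (1 - (r : ℝ) / Fintype.card V) ^ k := by
  induction k with
  | zero => exact ⟨∅, by simp, by simp⟩
  | succ k ih =>
    obtain ⟨T, hT, hle⟩ := ih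
    set U := H.filter (fun e => Disjoint e T) with hU
    have hdc : ∑ v : V, (U.filter (fun e => v ∈ e)).card = U.card * r := by
      have := Finset.sum_card_bipartiteAbove_eq_sum_card_bipartiteBelow
        (s := (univ : Finset V)) (t := U) (fun v e => v ∈ e)
      simp only [bipartiteAbove, bipartiteBelow] at this
      rw [this, sum_congr rfl (g := fun _ => r), sum_const, smul_eq_mul]
      intro e he
      rw [filter_mem_eq_inter, univ_inter]
      exact hH e (mem_filter.mp he).1
    have hne : Nonempty V := Fintype.card_pos_iff.mp hV
    obtain ⟨v, -, hv⟩ := Finset.exists_le_of_sum_le (s := (univ : Finset V)) univ_nonempty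
      (f := fun _ => ((U.card * r : ℕ) : ℝ) / Fintype.card V)
      (g := fun v => ((U.filter (fun e => v ∈ e)).card : ℝ)) (by
        rw [sum_const, card_univ, nsmul_eq_mul, mul_div_cancel₀ _ (by positivity), ← hdc]
        push_cast; rfl)
    refine ⟨insert v T, (card_insert_le _ _).trans (by omega), ?_⟩
    have hsub : H.filter (fun e => Disjoint e (insert v T)) = U.filter (fun e => ¬ v ∈ e) := by
      ext e
      simp only [hU, mem_filter, disjoint_insert_right]
      tauto
    have hc := card_filter_add_card_filter_not (s := U) (fun e => v ∈ e)
    have hc' : ((U.filter (fun e => v ∈ e)).card : ℝ) + ((U.filter (fun e => ¬ v ∈ e)).card : ℝ)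
      = U.card := by exact_mod_cast hc
    rw [hsub]
    have hnn : 0 ≤ 1 - (r : ℝ) / Fintype.card V := by
      have h1 : (r : ℝ) ≤ Fintype.card V := by exact_mod_cast hr
      have h2 : (r : ℝ) / Fintype.card V ≤ 1 := div_le_one_of_le₀ h1 (by positivity)
      linarith
    have hmain : ((U.filter (fun e => ¬ v ∈ e)).card : ℝ) ≤
        U.card * (1 - (r : ℝ) / Fintype.card V) := by
      have : ((U.card * r : ℕ) : ℝ) / Fintype.card V = U.card * ((r : ℝ) / Fintype.card V) := by
        push_cast; ring
      rw [this] at hv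
      linarith
    calc _ ≤ U.card * (1 - (r : ℝ) / Fintype.card V) := hmain
      _ ≤ (H.card * (1 - (r : ℝ) / Fintype.card V) ^ k) * (1 - (r : ℝ) / Fintype.card V) :=
          mul_le_mul_of_nonneg_right hle hnn
      _ = _ := by rw [pow_succ]; ring

theorem lower {V : Type} [Fintype V] [DecidableEq V] (H : Finset (Finset V)) (r n : ℕ)
    (hr2 : 2 ≤ r) (hn : Fintype.card V = n) (hrn : r ≤ n)
    (hH : ∀ e ∈ H, e.card = r) (hc : coverNumber H = r) :
    (2 : ℝ) ^ ((1 / 2 : ℝ) * (r : ℝ) ^ 2 / (n : ℝ)) ≤ (H.card : ℝ) := by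
  subst hn
  have hV : 0 < Fintype.card V := by omega
  obtain ⟨T, hT, hle⟩ := greedy H r hH hV hrn (r - 1)
  have h1 : 1 ≤ (H.filter (fun e => Disjoint e T)).card := by
    by_contra hcon
    have h0 : H.filter (fun e => Disjoint e T) = ∅ := by
      rw [← card_eq_zero]; omega
    have hcov : coverNumber H ≤ T.card := by
      apply Nat.sInf_le
      refine ⟨T, rfl, fun e he => ?_⟩
      rw [nonempty_iff_ne_empty]
      intro h
      have : e ∈ H.filter (fun e => Disjoint e T) :=
        mem_filter.mpr ⟨he, disjoint_iff_inter_eq_empty.mpr h⟩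
      rw [h0] at this
      exact absurd this (notMem_empty _)
    omega
  have h1' : (1 : ℝ) ≤ (H.filter (fun e => Disjoint e T)).card := by exact_mod_cast h1
  set n := Fintype.card V
  have hn0 : (0 : ℝ) < n := by exact_mod_cast hV
  have hrn' : (r : ℝ) ≤ n := by exact_mod_cast hrn
  have hx : (r : ℝ) / n ≤ 1 := div_le_one_of_le₀ hrn' hn0.le
  have h2 : (1 - (r : ℝ) / n) ^ (r - 1) ≤ Real.exp (-((r : ℝ) ^ 2 / (2 * n))) := by
    calc (1 - (r : ℝ) / n) ^ (r - 1) ≤ (Real.exp (-((r : ℝ) / n))) ^ (r - 1) := by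
          apply pow_le_pow_left₀ (by linarith)
          have := Real.add_one_le_exp (-((r : ℝ) / n))
          linarith
      _ = Real.exp (((r - 1 : ℕ) : ℝ) * (-((r : ℝ) / n))) := by rw [← Real.exp_nat_mul]
      _ ≤ _ := by
          apply Real.exp_le_exp.mpr
          rw [Nat.cast_sub (by omega), Nat.cast_one]
          have hr2' : (2 : ℝ) ≤ r := by exact_mod_cast hr2
          have : (r : ℝ) ^ 2 / (2 * n) = (r / 2) * (r / n) := by field_simp
          rw [this]
          have hp : 0 ≤ (r : ℝ) / n := by positivity
          nlinarith
  have h3 : 1 ≤ (H.card : ℝ) * Real.exp (-((r : ℝ) ^ 2 / (2 * n))) :=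
    h1'.trans (hle.trans (mul_le_mul_of_nonneg_left h2 (Nat.cast_nonneg _)))
  rw [Real.exp_neg, ← div_eq_mul_inv, one_le_div (Real.exp_pos _)] at h3
  refine le_trans ?_ h3
  rw [Real.rpow_def_of_pos (by norm_num)]
  apply Real.exp_le_exp.mpr
  have hlog : Real.log 2 ≤ 1 := by linarith [Real.log_two_lt_d9]
  have : (1 / 2 : ℝ) * (r : ℝ) ^ 2 / n = (r : ℝ) ^ 2 / (2 * n) := by field_simp
  rw [this]
  have hp : 0 ≤ (r : ℝ) ^ 2 / (2 * n) := by positivity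
  nlinarith

theorem upper_small (r n : ℕ) (K : ℝ) (hr2 : 2 ≤ r) (h1 : 2 * r - 1 ≤ n)
    (hK : (r : ℝ) ≤ K * ((r : ℝ) ^ 2 / n)) :
    ∃ H : Finset (Finset (Fin n)),
      (∀ e ∈ H, e.card = r) ∧ (∀ e ∈ H, ∀ f ∈ H, (e ∩ f).Nonempty) ∧
      coverNumber H = r ∧
      (H.card : ℝ) ≤ ((n : ℝ) / (r : ℝ)) ^ (4 * (K * ((r : ℝ) ^ 2 / n))) := by
  have g := good_one.majority r (by omega) le_rfl le_rfl
  rw [mul_one, mul_one, one_pow, mul_one] at g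
  obtain ⟨H, a, b, c, d⟩ := g.toFin (by omega) h1
  refine ⟨H, a, b, c, ?_⟩
  have hr0 : (0 : ℝ) < r := by positivity
  have hbase : (3 / 2 : ℝ) ≤ (n : ℝ) / r := by
    rw [le_div_iff₀ hr0]
    have : 3 * r ≤ 2 * n := by omega
    have : (3 : ℝ) * r ≤ 2 * n := by exact_mod_cast this
    linarith
  calc (H.card : ℝ) ≤ (4 : ℝ) ^ r := by exact_mod_cast d
    _ ≤ ((3 / 2 : ℝ) ^ 4) ^ r := pow_le_pow_left₀ (by norm_num) (by norm_num) _
    _ = (3 / 2 : ℝ) ^ ((4 * r : ℝ)) := by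
        rw [← pow_mul, ← Real.rpow_natCast]; push_cast; rfl
    _ ≤ ((n : ℝ) / r) ^ ((4 * r : ℝ)) :=
        Real.rpow_le_rpow (by norm_num) hbase (by positivity)
    _ ≤ _ := Real.rpow_le_rpow_of_exponent_le (by linarith) (by linarith)

set_option maxHeartbeats 1000000 in
theorem upper_large (r n : ℕ) (hn : n ≤ r ^ 2) (h10 : 10 * r ≤ n) (hr : 16 ^ 255 ≤ r) :
    ∃ H : Finset (Finset (Fin n)),
      (∀ e ∈ H, e.card = r) ∧ (∀ e ∈ H, ∀ f ∈ H, (e ∩ f).Nonempty) ∧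
      coverNumber H = r ∧
      (H.card : ℝ) ≤ ((n : ℝ) / (r : ℝ)) ^ (280 * ((r : ℝ) ^ 2 / n)) := by
  have hr0 : 1 ≤ r := le_trans (Nat.one_le_pow _ _ (by norm_num)) hr
  have hx0 : n / (10 * r) ≠ 0 := by
    have := Nat.div_pos h10 (by omega)
    omega
  obtain ⟨p, hp, hp1, hp2⟩ := Nat.exists_prime_lt_and_le_two_mul _ hx0
  have hpt := hp.two_le
  have hxa : (n / (10 * r)) * (10 * r) ≤ n := Nat.div_mul_le_self _ _
  have hxb : n < 10 * r * p := by
    have h1 := Nat.lt_mul_div_succ n (show 0 < 10 * r by omega)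
    exact h1.trans_le (Nat.mul_le_mul_left _ hp1)
  have h5 : 5 * r * p ≤ n := by nlinarith
  have h5' : 5 * p ≤ r := by
    have : r * (5 * p) ≤ r * r := by nlinarith
    exact Nat.le_of_mul_le_mul_left this (by omega)
  obtain ⟨s, hs⟩ : ∃ s, s = r / (p + 1) := ⟨_, rfl⟩
  obtain ⟨ρ, hρ⟩ : ∃ ρ, ρ = r % (p + 1) := ⟨_, rfl⟩
  have hρp : ρ < p + 1 := hρ ▸ Nat.mod_lt _ (by omega)
  have hsr : s * (p + 1) + ρ = r := by
    rw [hs, hρ, mul_comm]; exact Nat.div_add_mod _ _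
  have hs1 : 1 ≤ s := by
    rw [hs]; exact Nat.div_pos (by omega) (by omega)
  have g := (good_plane p hp).majority s hs1 (by omega) (by omega)
  have hsp : p + 1 ≤ s * (p + 1) := Nat.le_mul_of_pos_left _ hs1
  have g2 := g.add_rem ρ (by omega) (Nat.one_le_iff_ne_zero.mpr (by positivity)) (by rw [hsr]; exact hr)
  rw [hsr] at g2
  have hN : (2 * s - 1) * (p ^ 2 + p + 1) + r * ρ ≤ n := by
    have e1 : (2 * s - 1) * (p ^ 2 + p + 1) ≤ 2 * s * (p + 1) ^ 2 :=
      Nat.mul_le_mul (by omega) (by nlinarith)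
    have e2 : r * ρ ≤ r * p := Nat.mul_le_mul_left _ (by omega)
    have e3 : 2 * s * (p + 1) ^ 2 ≤ 2 * r * (p + 1) := by
      have : s * (p + 1) ≤ r := by omega
      nlinarith
    nlinarith
  obtain ⟨H, a, b, c, d⟩ := g2.toFin hr0 hN
  refine ⟨H, a, b, c, ?_⟩
  clear hr g g2 a b c
  have hrp : r ≤ p ^ (s + 3) := by
    have e1 : s ≤ 2 ^ s := Nat.lt_two_pow_self.le
    have e2 : 2 ^ s ≤ p ^ s := Nat.pow_le_pow_left hpt s
    have e3 : 4 ≤ p ^ 2 := by nlinarith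
    have e4 : r ≤ 4 * s * p := by nlinarith
    calc r ≤ 4 * s * p := e4
      _ ≤ p ^ 2 * p ^ s * p := Nat.mul_le_mul_right _ (Nat.mul_le_mul e3 (e1.trans e2))
      _ = p ^ (s + 3) := by ring
  have hM : 16 * r ^ 4 * (4 ^ s * (p ^ 2 + p + 1) ^ (2 * s)) ≤ p ^ (28 * s) := by
    have f1 : 16 ≤ p ^ 4 := by
      calc 16 = 2 ^ 4 := by norm_num
        _ ≤ p ^ 4 := Nat.pow_le_pow_left hpt 4
    have f2 : r ^ 4 ≤ (p ^ (s + 3)) ^ 4 := Nat.pow_le_pow_left hrp 4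
    have f3 : 4 ^ s ≤ (p ^ 2) ^ s := Nat.pow_le_pow_left (by nlinarith) s
    have f4 : (p ^ 2 + p + 1) ^ (2 * s) ≤ (p ^ 3) ^ (2 * s) := by
      apply Nat.pow_le_pow_left
      obtain ⟨k, rfl⟩ : ∃ k, p = k + 2 := ⟨p - 2, by omega⟩
      ring_nf
      nlinarith [Nat.zero_le (k ^ 3), Nat.zero_le (k ^ 2)]
    calc 16 * r ^ 4 * (4 ^ s * (p ^ 2 + p + 1) ^ (2 * s))
        ≤ p ^ 4 * (p ^ (s + 3)) ^ 4 * ((p ^ 2) ^ s * (p ^ 3) ^ (2 * s)) :=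
          Nat.mul_le_mul (Nat.mul_le_mul f1 f2) (Nat.mul_le_mul f3 f4)
      _ = p ^ (12 * s + 16) := by ring
      _ ≤ p ^ (28 * s) := Nat.pow_le_pow_right (by omega) (by omega)
  have hrR : (0 : ℝ) < r := by exact_mod_cast hr0
  have hnR : (0 : ℝ) < n := by
    have : 0 < n := by omega
    exact_mod_cast this
  have hpn : (p : ℝ) ≤ (n : ℝ) / r := by
    rw [le_div_iff₀ hrR]
    have : p * r ≤ n := by nlinarith
    exact_mod_cast this
  have hp1R : (1 : ℝ) ≤ p := by exact_mod_cast hp.one_le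
  have hexp : ((28 * s : ℕ) : ℝ) ≤ 280 * ((r : ℝ) ^ 2 / n) := by
    have : s * n ≤ 10 * r ^ 2 := by
      have q1 : s * n ≤ s * (10 * r * p) := Nat.mul_le_mul_left _ hxb.le
      have q2 : s * p ≤ r := by nlinarith
      have q3 : 10 * r * (s * p) ≤ 10 * r * r := Nat.mul_le_mul_left _ q2
      calc s * n ≤ s * (10 * r * p) := q1
        _ = 10 * r * (s * p) := by ring
        _ ≤ 10 * r * r := q3
        _ = 10 * r ^ 2 := by ring
    have h' : (s : ℝ) * n ≤ 10 * (r : ℝ) ^ 2 := by exact_mod_cast this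
    rw [← mul_div_assoc, le_div_iff₀ hnR]
    push_cast
    linarith
  calc (H.card : ℝ) ≤ (p : ℝ) ^ (28 * s) := by exact_mod_cast d.trans hM
    _ ≤ ((n : ℝ) / r) ^ (28 * s) := pow_le_pow_left₀ (by linarith) hpn _
    _ = ((n : ℝ) / r) ^ ((28 * s : ℕ) : ℝ) := (Real.rpow_natCast _ _).symm
    _ ≤ _ := Real.rpow_le_rpow_of_exponent_le (by linarith) hexp

theorem stmt_0 :
    ∃ c C : ℝ, 0 < c ∧ 0 < C ∧
      ∀ r n : ℕ, 3 ≤ 2 * r - 1 → 2 * r - 1 ≤ n → n ≤ r ^ 2 →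
        ((∀ (V : Type) [Fintype V] [DecidableEq V], Fintype.card V = n →
            ∀ H : Finset (Finset V),
              (∀ e ∈ H, e.card = r) →
              (∀ e ∈ H, ∀ f ∈ H, (e ∩ f).Nonempty) →
              coverNumber H = r →
              (2 : ℝ) ^ (c * (r : ℝ) ^ 2 / (n : ℝ)) ≤ (H.card : ℝ)) ∧
          ∃ H : Finset (Finset (Fin n)),
            (∀ e ∈ H, e.card = r) ∧
            (∀ e ∈ H, ∀ f ∈ H, (e ∩ f).Nonempty) ∧
            coverNumber H = r ∧
            (H.card : ℝ) ≤ ((n : ℝ) / (r : ℝ)) ^ (C * (r : ℝ) ^ 2 / (n : ℝ))) := by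
  obtain ⟨R, hR⟩ : ∃ R : ℕ, R = 16 ^ 255 := ⟨_, rfl⟩
  refine ⟨1 / 2, 4 * (R + 10) + 280, by norm_num, by positivity, ?_⟩
  intro r n h3 h1 h2
  have hr2 : 2 ≤ r := by omega
  have hr0 : (0 : ℝ) < r := by positivity
  have hn0 : (0 : ℝ) < n := by
    have : 0 < n := by omega
    exact_mod_cast this
  have hbase : (1 : ℝ) ≤ (n : ℝ) / r := by
    rw [le_div_iff₀ hr0]
    have : r ≤ n := by omega
    rw [one_mul]
    exact_mod_cast this
  have hq : 0 ≤ (r : ℝ) ^ 2 / n := by positivity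
  have hRn : (0 : ℝ) ≤ R := Nat.cast_nonneg R
  refine ⟨fun V _ _ hV H hH _ hc => lower H r n hr2 hV (by omega) hH hc, ?_⟩
  by_cases hcase : 10 * r ≤ n ∧ R ≤ r
  · obtain ⟨H, a, b, c, d⟩ := upper_large r n h2 hcase.1 (hR ▸ hcase.2)
    refine ⟨H, a, b, c, d.trans (Real.rpow_le_rpow_of_exponent_le hbase ?_)⟩
    rw [mul_div_assoc]
    nlinarith
  · have hK : (r : ℝ) ≤ ((R : ℝ) + 10) * ((r : ℝ) ^ 2 / n) := by
      rw [not_and_or] at hcase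
      rcases hcase with h | h
      · have h' : n ≤ 10 * r := by omega
        have h'' : (n : ℝ) ≤ 10 * r := by exact_mod_cast h'
        have : (r : ℝ) ≤ 10 * ((r : ℝ) ^ 2 / n) := by
          rw [← mul_div_assoc, le_div_iff₀ hn0]
          nlinarith
        nlinarith
      · have h' : (r : ℝ) ≤ R := by
          have : r ≤ R := by omega
          exact_mod_cast this
        have h'' : 1 ≤ (r : ℝ) ^ 2 / n := by
          rw [le_div_iff₀ hn0, one_mul]
          exact_mod_cast h2
        nlinarith
    obtain ⟨H, a, b, c, d⟩ := upper_small r n _ hr2 h1 hK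
    refine ⟨H, a, b, c, d.trans (Real.rpow_le_rpow_of_exponent_le hbase ?_)⟩
    rw [mul_div_assoc]
    nlinarith
end

section
/- There exists a constant C > 0 such that for all integers n ≥ 2r−1 ≥ 3, there exists an n-vertex r-uniform intersecting hypergraph with cover number equal to r having at most max{(n/r)^(C·r²/n), C·r} edges. -/
open Finset

lemma binom_bound (a N L k b : ℕ) (hk : 1 ≤ k) (hkN : 5 * k ≤ 2 * N) (hL : L ≤ a * N)
    (hb : (54 * a : ℝ) * (4/5 : ℝ) ^ b ≤ 1/3) :
    (L.choose k : ℝ) * (N.choose (2*k)) * ((2*k : ℝ) / N) ^ (k * (b+3)) ≤ (1/3 : ℝ)^k := by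
  have hN : 0 < N := by omega
  have hN' : (0:ℝ) < N := by exact_mod_cast hN
  have hk' : (0:ℝ) < k := by exact_mod_cast hk
  have he : ∀ m : ℕ, (m:ℝ)^m / m.factorial ≤ 3^m := by
    intro m
    have h1 := Real.pow_div_factorial_le_exp (m:ℝ) (by positivity) m
    refine h1.trans ?_
    have : Real.exp (m:ℝ) = (Real.exp 1)^m := by rw [← Real.exp_nat_mul]; simp
    rw [this]
    have := Real.exp_one_lt_three
    gcongr
  have hch : ∀ (n m : ℕ) (x : ℝ), 0 < m → (n : ℝ) ≤ x → (n.choose m : ℝ) ≤ (3 * x / m)^m := by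
    intro n m x hm hx
    have hm' : (0:ℝ) < m := by exact_mod_cast hm
    have h0 : (0:ℝ) ≤ n := by positivity
    calc (n.choose m : ℝ) ≤ (n:ℝ)^m / m.factorial := Nat.choose_le_pow_div m n
      _ ≤ x^m / m.factorial := by gcongr
      _ = (x/m)^m * ((m:ℝ)^m / m.factorial) := by
          rw [div_pow]; field_simp
      _ ≤ (x/m)^m * 3^m := by
          have : 0 ≤ x := h0.trans hx
          gcongr; exact he m
      _ = _ := by rw [← mul_pow]; congr 1; ring
  have h1 := hch L k (a*N) hk (by exact_mod_cast hL)
  have h2 := hch N (2*k) N (by omega) le_rfl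
  set y : ℝ := (2*k : ℝ)/N with hy
  have hy0 : 0 < y := by positivity
  have hy1 : y ≤ 4/5 := by
    rw [hy, div_le_iff₀ hN']
    have : (5*k:ℝ) ≤ 2 * N := by exact_mod_cast hkN
    linarith
  have e1 : (3 * ((a:ℝ)*N) / k) = 6 * a / y := by rw [hy]; field_simp; ring
  have e2 : (3 * (N:ℝ) / ((2*k : ℕ):ℝ)) = 3 / y := by rw [hy]; push_cast; field_simp
  rw [e1] at h1
  rw [e2] at h2
  calc (L.choose k : ℝ) * (N.choose (2*k)) * y ^ (k * (b+3))
      ≤ (6 * a / y)^k * (3/y)^(2*k) * y ^ (k * (b+3)) := by gcongr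
    _ = (54 * a * y^b)^k := by
        have h3 : y^(k*(b+3)) = (y^(b+3))^k := by rw [← pow_mul, mul_comm]
        have h4 : (3/y)^(2*k) = ((3/y)^2)^k := by rw [← pow_mul]
        rw [h3, h4, ← mul_pow, ← mul_pow]
        congr 1
        field_simp
        ring
    _ ≤ (1/3)^k := by
        gcongr
        refine le_trans ?_ hb
        gcongr

lemma expander (a : ℕ) : ∃ b : ℕ, ∀ (A B : Type) [Fintype A] [Fintype B] [DecidableEq A]
    [DecidableEq B], Fintype.card A ≤ a * Fintype.card B →
    ∃ f : A → Fin b → B, ∀ S : Finset A, 5 * S.card ≤ 2 * Fintype.card B →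
      2 * S.card ≤ (S.biUnion fun x => univ.image (f x)).card := by
  classical
  obtain ⟨b, hb⟩ : ∃ b : ℕ, (54 * a : ℝ) * (4/5 : ℝ) ^ b ≤ 1/3 := by
    obtain ⟨b, hb⟩ := exists_pow_lt_of_lt_one (show (0:ℝ) < 1/3/(54*a+1) by positivity)
      (show (4/5:ℝ) < 1 by norm_num)
    refine ⟨b, ?_⟩
    rw [lt_div_iff₀ (by positivity)] at hb
    have : (0:ℝ) < (4/5)^b := by positivity
    nlinarith
  refine ⟨b+3, ?_⟩
  intro A B _ _ _ _ hAB
  set N := Fintype.card B with hN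
  set L := Fintype.card A with hL
  by_contra hcon
  push Not at hcon
  -- bad sets
  let bad : Finset A → Finset B → Finset (A × Fin (b+3) → B) := fun S Y =>
    Fintype.piFinset (fun p => if p.1 ∈ S then Y else univ)
  have hcover : (univ : Finset (A × Fin (b+3) → B)) ⊆
      (Icc 1 (2*N/5)).biUnion fun k => (powersetCard k (univ : Finset A)).biUnion fun S =>
        (powersetCard (2*k) (univ : Finset B)).biUnion fun Y => bad S Y := by
    intro f _
    obtain ⟨S, hS1, hS2⟩ := hcon (fun x κ => f (x, κ))
    have hpos : 1 ≤ S.card := by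
      rcases Nat.eq_zero_or_pos S.card with h | h
      · rw [h] at hS2; omega
      · exact h
    obtain ⟨Y, hY1, hY2⟩ := Finset.exists_superset_card_eq (n := 2 * S.card) hS2.le (by omega)
    simp only [mem_biUnion, mem_Icc, mem_powersetCard]
    refine ⟨S.card, ⟨hpos, by omega⟩, S, ⟨subset_univ _, rfl⟩, Y, ⟨subset_univ _, hY2⟩, ?_⟩
    simp only [bad, Fintype.mem_piFinset]
    rintro ⟨x, κ⟩
    by_cases hx : x ∈ S
    · simp only [hx, if_true]
      apply hY1
      simp only [mem_biUnion, mem_image]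
      exact ⟨x, hx, κ, mem_univ _, rfl⟩
    · simp [hx]
  have hbad : ∀ S Y, (bad S Y).card = (Y.card)^(S.card * (b+3)) * N^((L - S.card) * (b+3)) := by
    intro S Y
    simp only [bad, Fintype.card_piFinset]
    rw [Fintype.prod_prod_type]
    simp only [prod_const, card_univ, Fintype.card_fin]
    rw [← Finset.prod_mul_prod_compl S]
    congr 1
    · rw [Finset.prod_congr rfl (g := fun _ => Y.card^(b+3)) (fun x hx => by simp [hx])]
      rw [prod_const, ← pow_mul]; congr 1; ring
    · rw [Finset.prod_congr rfl (g := fun _ => N^(b+3)) (fun x hx => by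
        have : x ∉ S := by simpa using hx
        simp [this, hN])]
      rw [prod_const, ← pow_mul, card_compl]; congr 1; ring
  have hc := card_le_card hcover
  have hc2 : (N:ℝ)^(L*(b+3)) ≤ ∑ k ∈ Icc 1 (2*N/5), ((L.choose k : ℝ) * (N.choose (2*k)) *
      ((2*k:ℝ)^(k*(b+3)) * (N:ℝ)^((L-k)*(b+3)))) := by
    have h1 : (univ : Finset (A × Fin (b+3) → B)).card = N^(L*(b+3)) := by
      simp [hN, hL]
    rw [h1] at hc
    have h2 := hc.trans (card_biUnion_le.trans (sum_le_sum (fun k hk => card_biUnion_le.trans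
      (sum_le_sum (fun S hS => card_biUnion_le)))))
    have h3 : (∑ k ∈ Icc 1 (2*N/5), ∑ S ∈ powersetCard k (univ : Finset A),
        ∑ Y ∈ powersetCard (2*k) (univ : Finset B), (bad S Y).card) =
        ∑ k ∈ Icc 1 (2*N/5), ((L.choose k) * (N.choose (2*k)) *
      ((2*k)^(k*(b+3)) * N^((L-k)*(b+3)))) := by
      refine sum_congr rfl fun k _ => ?_
      rw [Finset.sum_congr rfl (g := fun _ => (N.choose (2*k)) *
        ((2*k)^(k*(b+3)) * N^((L-k)*(b+3))))]
      · rw [sum_const, card_powersetCard, card_univ, smul_eq_mul, mul_assoc]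
      · intro S hS
        rw [Finset.sum_congr rfl (g := fun _ => ((2*k)^(k*(b+3)) * N^((L-k)*(b+3))))]
        · rw [sum_const, card_powersetCard, card_univ, smul_eq_mul]
        · intro Y hY
          rw [hbad, (mem_powersetCard.1 hS).2, (mem_powersetCard.1 hY).2]
    rw [h3] at h2
    exact_mod_cast h2
  rcases Nat.eq_zero_or_pos N with h0 | h0
  · rw [h0] at hc2
    have : L = 0 := by rw [h0] at hAB; omega
    rw [this] at hc2
    norm_num at hc2
  have hN' : (0:ℝ) < N := by exact_mod_cast h0
  have hterm : ∀ k ∈ Icc 1 (2*N/5), ((L.choose k : ℝ) * (N.choose (2*k)) *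
      ((2*k:ℝ)^(k*(b+3)) * (N:ℝ)^((L-k)*(b+3)))) ≤ (1/3:ℝ)^k * (N:ℝ)^(L*(b+3)) := by
    intro k hk
    rw [mem_Icc] at hk
    by_cases hkL : k ≤ L
    · have := binom_bound a N L k b hk.1 (by omega) hAB hb
      have e : (N:ℝ)^(L*(b+3)) = (N:ℝ)^(k*(b+3)) * (N:ℝ)^((L-k)*(b+3)) := by
        rw [← pow_add, ← add_mul]; congr 2; omega
      rw [e, ← mul_assoc, ← mul_assoc]
      rw [div_pow, ← mul_div_assoc, div_le_iff₀ (by positivity)] at this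
      exact mul_le_mul_of_nonneg_right this (by positivity)
    · rw [Nat.choose_eq_zero_of_lt (by omega)]
      simp
  have hfin := hc2.trans (sum_le_sum hterm)
  rw [← Finset.sum_mul] at hfin
  have hgeo : ∑ k ∈ Icc 1 (2*N/5), (1/3:ℝ)^k < 1 := by
    have : ∀ n : ℕ, ∑ k ∈ Icc 1 n, (1/3:ℝ)^k = 1/2 - 1/2 * (1/3)^n := by
      intro n
      induction n with
      | zero => simp
      | succ n ih => rw [Finset.sum_Icc_succ_top (by omega), ih]; ring
    rw [this]
    have : (0:ℝ) < (1/3)^(2*N/5) := by positivity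
    linarith
  have : (0:ℝ) < (N:ℝ)^(L*(b+3)) := by positivity
  nlinarith

lemma mix {Q R : Type} [Fintype Q] [Fintype R] [DecidableEq Q] [DecidableEq R]
    (s D : ℕ) (hs : 10 ≤ s) (hD : 0 < D)
    (pos : Q → Fin s × Fin D → Fin s)
    (fib : ∀ q y, (univ.filter fun u => pos q u = y).card ≤ D)
    (G : Finset (Fin s × Fin s))
    (E1 : ∀ S : Finset (Fin s), 5 * S.card ≤ 2 * s →
      2 * S.card ≤ (univ.filter fun v => ∃ a ∈ S, (a, v) ∈ G).card)
    (E2 : ∀ S : Finset (Fin s), 5 * S.card ≤ 2 * s →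
      2 * S.card ≤ (univ.filter fun a => ∃ v ∈ S, (a, v) ∈ G).card)
    (T1 : Finset (Q × Fin s)) (T2 : Finset (R × Fin s))
    (cov : ∀ a v, (a, v) ∈ G → ∀ i, (∃ q, (q, pos q (a, i)) ∈ T1) ∨ ∃ ρ, (ρ, v) ∈ T2) :
    2 * s ≤ 2 * T1.card + T2.card ∨ 2 * s ≤ T1.card + 2 * T2.card := by
  classical
  set X : Finset (Fin s) := univ.filter fun a => ∃ i, ∀ q, (q, pos q (a, i)) ∉ T1 with hX
  set Y : Finset (Fin s) := univ.filter fun v => ∀ ρ, (ρ, v) ∉ T2 with hY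
  have hXc : s ≤ X.card + T1.card := by
    have h1 : Xᶜ ×ˢ (univ : Finset (Fin D)) ⊆
        T1.biUnion fun p => univ.filter fun u => pos p.1 u = p.2 := by
      rintro ⟨a, i⟩ h
      simp only [mem_product, mem_compl, hX, mem_filter, mem_univ, true_and, and_true] at h
      push Not at h
      obtain ⟨q, hq⟩ := h i
      simp only [mem_biUnion, mem_filter, mem_univ, true_and]
      exact ⟨_, hq, rfl⟩
    have h2 := (card_le_card h1).trans (card_biUnion_le_card_mul _ _ D (fun p _ => fib p.1 p.2))
    rw [card_product, card_univ, Fintype.card_fin] at h2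
    have h3 := Nat.le_of_mul_le_mul_right h2 hD
    have h4 := card_compl X
    rw [Fintype.card_fin] at h4
    omega
  have hYc : s ≤ Y.card + T2.card := by
    have h1 : Yᶜ ⊆ T2.image Prod.snd := by
      intro v h
      simp only [mem_compl, hY, mem_filter, mem_univ, true_and] at h
      push Not at h
      obtain ⟨ρ, hρ⟩ := h
      exact mem_image.2 ⟨_, hρ, rfl⟩
    have h2 := (card_le_card h1).trans card_image_le
    have h4 := card_compl Y
    rw [Fintype.card_fin] at h4
    omega
  have hno : ∀ a ∈ X, ∀ v ∈ Y, (a, v) ∉ G := by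
    intro a ha v hv hG
    simp only [hX, hY, mem_filter, mem_univ, true_and] at ha hv
    obtain ⟨i, hi⟩ := ha
    rcases cov a v hG i with ⟨q, hq⟩ | ⟨ρ, hρ⟩
    · exact hi q hq
    · exact hv ρ hρ
  have key1 : ∀ S ⊆ X, 5 * S.card ≤ 2 * s → 2 * S.card + Y.card ≤ s := by
    intro S hS h5
    have h1 := E1 S h5
    have h2 : (univ.filter fun v => ∃ a ∈ S, (a, v) ∈ G) ⊆ Yᶜ := by
      intro v hv
      simp only [mem_filter, mem_univ, true_and] at hv
      obtain ⟨a, ha, hG⟩ := hv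
      rw [mem_compl]
      exact fun hvY => hno a (hS ha) v hvY hG
    have h3 := card_le_card h2
    have h4 := card_compl Y
    have h5 := card_le_univ Y
    rw [Fintype.card_fin] at h4 h5
    omega
  have key2 : ∀ S ⊆ Y, 5 * S.card ≤ 2 * s → 2 * S.card + X.card ≤ s := by
    intro S hS h5
    have h1 := E2 S h5
    have h2 : (univ.filter fun a => ∃ v ∈ S, (a, v) ∈ G) ⊆ Xᶜ := by
      intro a hv
      simp only [mem_filter, mem_univ, true_and] at hv
      obtain ⟨v, hv, hG⟩ := hv
      rw [mem_compl]
      exact fun haX => hno a haX v (hS hv) hG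
    have h3 := card_le_card h2
    have h4 := card_compl X
    have h5 := card_le_univ X
    rw [Fintype.card_fin] at h4 h5
    omega
  by_cases c1 : 5 * X.card ≤ 2 * s
  · left
    have := key1 X subset_rfl c1
    omega
  by_cases c2 : 5 * Y.card ≤ 2 * s
  · right
    have := key2 Y subset_rfl c2
    omega
  exfalso
  obtain ⟨S, hS, hSc⟩ := exists_subset_card_eq (s := X) (n := 2 * s / 5) (by omega)
  have := key1 S hS (by omega)
  omega

/-- folding maps -/
lemma fold_exists (k : ℕ) (hk : 0 < k) :
    ∃ μ : (Bool × Fin (2*k)) → Fin (2*k) → Fin k,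
      (∀ x y, (univ.filter fun p => μ x p = y).card ≤ 2) ∧
      ∀ p q, ∃ x, μ x p = μ x q := by
  have : NeZero (2*k) := ⟨by omega⟩
  let φ : Bool → Fin (2*k) → Fin k := fun c z =>
    if c then (if h : z.1 < k then ⟨z.1, h⟩ else ⟨2*k-1-z.1, by omega⟩)
    else (if h0 : z.1 = 0 ∨ z.1 = k then ⟨0, hk⟩ else
      if h : z.1 < k then ⟨z.1, h⟩ else ⟨2*k-z.1, by omega⟩)
  have hφ : ∀ c y, ∃ z1 z2 : Fin (2*k), ∀ z, φ c z = y → z = z1 ∨ z = z2 := by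
    intro c y
    have hy := y.2
    cases c
    · by_cases h0 : y.1 = 0
      · refine ⟨⟨0, by omega⟩, ⟨k, by omega⟩, fun z hz => ?_⟩
        have hz2 := z.2
        simp only [φ, Bool.false_eq_true, if_false] at hz
        rw [Fin.ext_iff] at hz
        simp only [Fin.ext_iff]
        split_ifs at hz <;> simp at hz <;> omega
      · refine ⟨⟨y.1, by omega⟩, ⟨2*k-y.1, by omega⟩, fun z hz => ?_⟩
        have hz2 := z.2
        simp only [φ, Bool.false_eq_true, if_false] at hz
        rw [Fin.ext_iff] at hz
        simp only [Fin.ext_iff]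
        split_ifs at hz <;> simp at hz <;> omega
    · refine ⟨⟨y.1, by omega⟩, ⟨2*k-1-y.1, by omega⟩, fun z hz => ?_⟩
      have hz2 := z.2
      simp only [φ, if_true] at hz
      rw [Fin.ext_iff] at hz
      simp only [Fin.ext_iff]
      split_ifs at hz <;> simp at hz <;> omega
  refine ⟨fun x p => φ x.1 (p + x.2), ?_, ?_⟩
  · rintro ⟨c, x⟩ y
    obtain ⟨z1, z2, h⟩ := hφ c y
    have : (univ.filter fun p => φ c (p + x) = y) ⊆ {z1 - x, z2 - x} := by
      intro p hp
      simp only [mem_filter, mem_univ, true_and] at hp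
      simp only [mem_insert, mem_singleton]
      rcases h _ hp with h | h
      · left; rw [← h]; simp
      · right; rw [← h]; simp
    exact (card_le_card this).trans card_le_two
  · have main : ∀ p q : Fin (2*k), p.1 ≤ q.1 → ∃ x : Bool × Fin (2*k), φ x.1 (p + x.2) = φ x.1 (q + x.2) := by
      intro p q hpq
      have hp := p.2
      have hq := q.2
      by_cases hpar : (q.1 - p.1) % 2 = 1
      · -- want p + x = k - 1 - d, q + x = k + d, where 2d+1 = q - p
        obtain ⟨d, hd⟩ : ∃ d, q.1 - p.1 = 2*d+1 := ⟨(q.1-p.1)/2, by omega⟩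
        obtain ⟨z, hz⟩ : ∃ z : Fin (2*k), z.1 = k-1-d := ⟨⟨k-1-d, by omega⟩, rfl⟩
        obtain ⟨w, hw⟩ : ∃ w : Fin (2*k), w.1 = 2*d+1 := ⟨⟨2*d+1, by omega⟩, rfl⟩
        have hq' : q = p + w := by
          apply Fin.ext
          rw [Fin.val_add, Nat.mod_eq_of_lt (by omega)]; omega
        have hv : (w + z).1 = k + d := by
          rw [Fin.val_add, Nat.mod_eq_of_lt (by omega)]; omega
        refine ⟨(true, z - p), ?_⟩
        have e1 : p + (z - p) = z := by abel
        have e2 : q + (z - p) = w + z := by rw [hq']; abel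
        simp only
        rw [e1, e2]
        generalize w + z = y at hv
        simp only [φ, if_true]
        rw [dif_pos (by omega), dif_neg (by omega)]
        simp only [Fin.mk.injEq]; omega
      · obtain ⟨d, hd⟩ : ∃ d, q.1 - p.1 = 2*d := ⟨(q.1-p.1)/2, by omega⟩
        obtain ⟨z, hz⟩ : ∃ z : Fin (2*k), z.1 = k-d := ⟨⟨k-d, by omega⟩, rfl⟩
        obtain ⟨w, hw⟩ : ∃ w : Fin (2*k), w.1 = 2*d := ⟨⟨2*d, by omega⟩, rfl⟩
        have hq' : q = p + w := by
          apply Fin.ext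
          rw [Fin.val_add, Nat.mod_eq_of_lt (by omega)]; omega
        have hv : (w + z).1 = k + d := by
          rw [Fin.val_add, Nat.mod_eq_of_lt (by omega)]; omega
        refine ⟨(false, z - p), ?_⟩
        have e1 : p + (z - p) = z := by abel
        have e2 : q + (z - p) = w + z := by rw [hq']; abel
        simp only
        rw [e1, e2]
        generalize w + z = y at hv
        simp only [φ, Bool.false_eq_true, if_false]
        by_cases h0 : d = 0
        · rw [dif_pos (by omega), dif_pos (by omega)]
        · rw [dif_neg (by omega), dif_pos (by omega), dif_neg (by omega), dif_neg (by omega)]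
          simp only [Fin.mk.injEq]; omega
    intro p q
    rcases le_total p.1 q.1 with h | h
    · exact main p q h
    · obtain ⟨x, hx⟩ := main q p h
      exact ⟨x, hx.symm⟩
lemma udesign_base (E k D s : ℕ) (hE : 0 < E) (hD : D = 2 * E) (hk : 0 < k) (hs : s = D * k + 1)
    (hco : ∀ d, 0 < d → d < D → Nat.Coprime d s) :
    ∃ pos : (Fin s ⊕ (Fin 3 × (Bool × Fin (2*k)))) → Fin s × Fin D → Fin s,
      (∀ q y, (univ.filter fun u => pos q u = y).card ≤ D) ∧
      ∀ u v, ∃ q, pos q u = pos q v := by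
  classical
  obtain ⟨μ, hμ1, hμ2⟩ := fold_exists k hk
  have hDk : 2 * 1 * 1 ≤ D * k := by
    rw [hD]; exact Nat.mul_le_mul (by omega) hk
  have hs3 : 3 ≤ s := by omega
  have hs2 : s = 2 * k * E + 1 := by rw [hs, hD]; ring
  let sh : Fin 3 → Fin s → ℕ := fun c a => if c.1 ≤ a.1 then a.1 - c.1 else a.1 + s - c.1
  have hsh : ∀ c a, sh c a < s := by
    intro c a
    have := a.2
    have := c.2
    simp only [sh]; split_ifs <;> omega
  have hsh0 : ∀ c a, sh c a = 0 ↔ a.1 = c.1 := by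
    intro c a
    have := a.2
    have := c.2
    simp only [sh]; split_ifs <;> omega
  have hshinj : ∀ c a b, sh c a = sh c b → a = b := by
    intro c a b h
    have := a.2
    have := b.2
    have := c.2
    apply Fin.ext
    simp only [sh] at h; split_ifs at h <;> omega
  let P : Fin 3 → Fin s → Fin (2*k) := fun c a => ⟨(sh c a - 1) / E, by
    have := hsh c a
    rw [Nat.div_lt_iff_lt_mul hE]
    have : 0 < 2 * k * E := by positivity
    omega⟩
  have hlab : ∀ (i : Fin D) (m : Fin k), i.1 * k + m.1 < s - 1 := by
    intro i m
    have h1 := i.2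
    have h2 := m.2
    have : (i.1 + 1) * k ≤ D * k := Nat.mul_le_mul_right _ h1
    rw [add_mul] at this
    omega
  let pos : (Fin s ⊕ (Fin 3 × (Bool × Fin (2*k)))) → Fin s × Fin D → Fin s := fun q u =>
    match q with
    | Sum.inl x => ⟨(u.1.1 + x.1 * u.2.1) % s, Nat.mod_lt _ (by omega)⟩
    | Sum.inr (c, x) => if sh c u.1 = 0 then ⟨s - 1, by omega⟩ else
        ⟨u.2.1 * k + (μ x (P c u.1)).1, by have := hlab u.2 (μ x (P c u.1)); omega⟩
  have pos1 : ∀ x u, (pos (Sum.inl x) u).1 = (u.1.1 + x.1 * u.2.1) % s := fun x u => rfl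
  have pos2 : ∀ c x u, sh c u.1 = 0 → (pos (Sum.inr (c, x)) u).1 = s - 1 := by
    intro c x u h
    simp only [pos]
    rw [if_pos h]
  have pos3 : ∀ c x u, sh c u.1 ≠ 0 →
      (pos (Sum.inr (c, x)) u).1 = u.2.1 * k + (μ x (P c u.1)).1 := by
    intro c x u h
    simp only [pos]
    rw [if_neg h]
  clear_value pos
  refine ⟨pos, ?_, ?_⟩
  · intro q y
    rcases q with x | ⟨c, x⟩
    · calc _ ≤ (univ : Finset (Fin D)).card := by
            apply card_le_card_of_injOn (fun u => u.2) (fun _ _ => mem_univ _)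
            rintro ⟨a, i⟩ ha ⟨b, j⟩ hb h
            simp only [coe_filter, mem_univ, true_and, Set.mem_ofPred_eq] at ha hb h
            subst h
            have h1 : (pos (Sum.inl x) (a, i)).1 = (pos (Sum.inl x) (b, i)).1 := by rw [ha, hb]
            rw [pos1, pos1] at h1
            have h2 : a.1 ≡ b.1 [MOD s] := Nat.ModEq.add_right_cancel' _ h1
            rw [Nat.ModEq, Nat.mod_eq_of_lt a.2, Nat.mod_eq_of_lt b.2] at h2
            rw [Fin.ext h2]
        _ = D := by simp
    · by_cases hy : y.1 = s - 1
      · have hz : ∀ u, pos (Sum.inr (c, x)) u = y → u.1.1 = c.1 := by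
          intro u hu
          by_contra hne
          have h0 : sh c u.1 ≠ 0 := fun h => hne ((hsh0 _ _).1 h)
          have h1 := pos3 c x u h0
          have h2 := hlab u.2 (μ x (P c u.1))
          rw [hu] at h1
          omega
        calc _ ≤ (univ : Finset (Fin D)).card := by
              apply card_le_card_of_injOn (fun u => u.2) (fun _ _ => mem_univ _)
              rintro ⟨a, i⟩ ha ⟨b, j⟩ hb h
              simp only [coe_filter, mem_univ, true_and, Set.mem_ofPred_eq] at ha hb h
              subst h
              have := hz _ ha
              have := hz _ hb
              simp only at *
              have : a = b := Fin.ext (by omega)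
              rw [this]
          _ = D := by simp
      · have hz : ∀ u, pos (Sum.inr (c, x)) u = y → sh c u.1 ≠ 0 ∧ u.2.1 = y.1 / k ∧
            (μ x (P c u.1)).1 = y.1 % k := by
          intro u hu
          have h0 : sh c u.1 ≠ 0 := by
            intro h
            have := pos2 c x u h
            rw [hu] at this
            omega
          have h1 := pos3 c x u h0
          rw [hu] at h1
          refine ⟨h0, ?_, ?_⟩
          · rw [h1, add_comm, mul_comm, Nat.add_mul_div_left _ _ hk,
              Nat.div_eq_of_lt (μ x (P c u.1)).2, zero_add]
          · rw [h1, add_comm, Nat.add_mul_mod_self_right, Nat.mod_eq_of_lt (μ x (P c u.1)).2]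
        calc _ ≤ ((univ.filter fun p => μ x p = ⟨y.1 % k, Nat.mod_lt _ hk⟩) ×ˢ
                (univ : Finset (Fin E))).card := by
              apply card_le_card_of_injOn
                (fun u => (P c u.1, (⟨(sh c u.1 - 1) % E, Nat.mod_lt _ hE⟩ : Fin E)))
              · intro u hu
                simp only [coe_filter, mem_univ, true_and, Set.mem_ofPred_eq] at hu
                simp only [coe_product, Set.mem_prod, coe_filter, mem_univ, true_and,
                  Set.mem_ofPred_eq, coe_univ, Set.mem_univ, and_true]
                exact Fin.ext (hz u hu).2.2
              · rintro ⟨a, i⟩ ha ⟨b, j⟩ hb h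
                simp only [coe_filter, mem_univ, true_and, Set.mem_ofPred_eq] at ha hb
                simp only [Prod.mk.injEq, P, Fin.mk.injEq] at h
                obtain ⟨ha1, ha2, ha3⟩ := hz _ ha
                obtain ⟨hb1, hb2, hb3⟩ := hz _ hb
                simp only at ha1 ha2 hb1 hb2
                have e : sh c a - 1 = sh c b - 1 := by
                  rw [← Nat.div_add_mod (sh c a - 1) E, h.1, h.2, Nat.div_add_mod]
                have e1 := hshinj c a b (by omega)
                have e2 : i = j := Fin.ext (by omega)
                rw [e1, e2]
          _ ≤ 2 * E := by
              rw [card_product, card_univ, Fintype.card_fin]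
              exact Nat.mul_le_mul_right _ (hμ1 _ _)
          _ = D := hD.symm
  · have main : ∀ (a b : Fin s) (i j : Fin D), i.1 < j.1 → ∃ q, pos q (a, i) = pos q (b, j) := by
      intro a b i j hij
      obtain ⟨m, hm⟩ := Nat.exists_mul_mod_eq_one_of_coprime
        (hco (j.1 - i.1) (by omega) (by have := j.2; omega)) (by omega : 1 < s)
      refine ⟨Sum.inl ⟨(m * (a.1 + (s - b.1))) % s, Nat.mod_lt _ (by omega)⟩, ?_⟩
      apply Fin.ext
      rw [pos1, pos1]
      simp only
      set x := (m * (a.1 + (s - b.1))) % s with hx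
      have h1 : x ≡ m * (a.1 + (s - b.1)) [MOD s] := Nat.mod_modEq _ _
      have h2 : (j.1 - i.1) * m ≡ 1 [MOD s] := by
        rw [Nat.ModEq, hm.2, Nat.mod_eq_of_lt (by omega)]
      have h3 : (j.1 - i.1) * x ≡ a.1 + (s - b.1) [MOD s] := by
        calc (j.1 - i.1) * x ≡ (j.1 - i.1) * (m * (a.1 + (s - b.1))) [MOD s] := h1.mul_left _
          _ = (j.1 - i.1) * m * (a.1 + (s - b.1)) := by ring
          _ ≡ 1 * (a.1 + (s - b.1)) [MOD s] := h2.mul_right _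
          _ = _ := one_mul _
      have h4 : b.1 + x * j.1 = b.1 + x * i.1 + (j.1 - i.1) * x := by
        have : j.1 = i.1 + (j.1 - i.1) := by omega
        rw [this]; simp; ring
      have h5 : b.1 + x * j.1 ≡ a.1 + x * i.1 [MOD s] := by
        rw [h4]
        calc b.1 + x * i.1 + (j.1 - i.1) * x ≡ b.1 + x * i.1 + (a.1 + (s - b.1)) [MOD s] :=
              h3.add_left _
          _ = a.1 + x * i.1 + s := by have := b.2; omega
          _ ≡ a.1 + x * i.1 [MOD s] := by simp [Nat.ModEq]
      exact h5.symm
    rintro ⟨a, i⟩ ⟨b, j⟩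
    rcases lt_trichotomy i.1 j.1 with h | h | h
    · exact main a b i j h
    · have hij : i = j := Fin.ext h
      subst hij
      obtain ⟨c, hc1, hc2⟩ : ∃ c : Fin 3, a.1 ≠ c.1 ∧ b.1 ≠ c.1 := by
        by_contra hcon
        push Not at hcon
        have h0 := hcon 0
        have h1 := hcon 1
        have h2 := hcon 2
        simp at h0 h1 h2
        omega
      obtain ⟨x, hx⟩ := hμ2 (P c a) (P c b)
      refine ⟨Sum.inr (c, x), ?_⟩
      apply Fin.ext
      rw [pos3 _ _ _ (fun h => hc1 ((hsh0 _ _).1 h)), pos3 _ _ _ (fun h => hc2 ((hsh0 _ _).1 h)), hx]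
    · obtain ⟨q, hq⟩ := main b a j i h
      exact ⟨q, hq.symm⟩

lemma udesign (Q : Type) [Fintype Q] (E k D s : ℕ) (hE : 0 < E) (hD : D = 2 * E) (hk : 0 < k)
    (hs : s = D * k + 1) (hco : ∀ d, 0 < d → d < D → Nat.Coprime d s)
    (hQ : s + 12 * k ≤ Fintype.card Q) :
    ∃ pos : Q → Fin s × Fin D → Fin s,
      (∀ q y, (univ.filter fun u => pos q u = y).card ≤ D) ∧
      ∀ u v, ∃ q, pos q u = pos q v := by
  obtain ⟨pos, h1, h2⟩ := udesign_base E k D s hE hD hk hs hco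
  have hc : Fintype.card (Fin s ⊕ (Fin 3 × (Bool × Fin (2*k)))) ≤ Fintype.card Q := by
    simp only [Fintype.card_sum, Fintype.card_prod, Fintype.card_fin, Fintype.card_bool]
    omega
  obtain ⟨f⟩ := Function.Embedding.nonempty_of_card_le hc
  have : Nonempty (Fin s ⊕ (Fin 3 × (Bool × Fin (2*k)))) := ⟨Sum.inl ⟨0, by omega⟩⟩
  refine ⟨fun q => pos (Function.invFun f q), fun q y => h1 _ _, fun u v => ?_⟩
  obtain ⟨q, hq⟩ := h2 u v
  refine ⟨f q, ?_⟩
  simp only [Function.leftInverse_invFun f.injective q]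
  exact hq
/-- `T` meets every edge of `H`. -/
def Hits {V : Type} (H : Finset (Finset V)) (T : Finset V) : Prop :=
  ∀ e ∈ H, ∃ x ∈ e, x ∈ T

/-- `r`-uniform, intersecting, no cover with fewer than `r` vertices. -/
structure Good_s1 {V : Type} (H : Finset (Finset V)) (r : ℕ) : Prop where
  unif : ∀ e ∈ H, e.card = r
  inter : ∀ e ∈ H, ∀ f ∈ H, ∃ x ∈ e, x ∈ f
  cov : ∀ T : Finset V, Hits H T → r ≤ T.card

/-- A family of `s` chunks inside `H`, such that covering `m` chunks takes at least `m` vertices. -/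
structure Chunked {V : Type} (H : Finset (Finset V)) (s D : ℕ) (c : Fin s → Finset (Finset V)) :
    Prop where
  sub : ∀ i, c i ⊆ H
  card_le : ∀ i, (c i).card ≤ D
  cov : ∀ (T : Finset V) (X : Finset (Fin s)), (∀ i ∈ X, Hits (c i) T) → X.card ≤ T.card

lemma step {V0 : Type} (H0 : Finset (Finset V0)) (r0 s0 D' : ℕ)
    (c0 : Fin s0 → Finset (Finset V0))
    (hg : Good_s1 H0 r0) (hc : Chunked H0 s0 D' c0) (hr0 : 30 ≤ r0) (hs0 : 9 * r0 ≤ 10 * s0)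
    (s D b b3 : ℕ) (hs : 10 ≤ s) (hD : 0 < D)
    (Q R : Type) [Fintype Q] [Fintype R] [DecidableEq Q] [DecidableEq R]
    (hQR : Fintype.card Q + Fintype.card R = r0 + s) (hR : 9 * r0 ≤ 10 * Fintype.card R)
    (pos : Q → Fin s × Fin D → Fin s)
    (fib : ∀ q y, (univ.filter fun u => pos q u = y).card ≤ D)
    (agree : ∀ u v, ∃ q, pos q u = pos q v)
    (G : Finset (Fin s × Fin s))
    (E1 : ∀ S : Finset (Fin s), 5 * S.card ≤ 2 * s →
      2 * S.card ≤ (univ.filter fun v => ∃ a ∈ S, (a, v) ∈ G).card)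
    (E2 : ∀ S : Finset (Fin s), 5 * S.card ≤ 2 * s →
      2 * S.card ≤ (univ.filter fun a => ∃ v ∈ S, (a, v) ∈ G).card)
    (hdiag : ∀ a, (a, a) ∈ G)
    (z : Fin r0 → V0) (π : Finset V0 → Fin r0) (hπ : ∀ h ∈ H0, z (π h) ∈ h)
    (α : Fin r0 × Bool → Q) (hα : Function.Injective α)
    (f2 : Fin r0 → Fin b → R)
    (hf2 : ∀ S : Finset (Fin r0), 5 * S.card ≤ 2 * Fintype.card R →
      2 * S.card ≤ (S.biUnion fun x => univ.image (f2 x)).card)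
    (f3 : Q ⊕ R → Fin b3 → Fin s0)
    (hf3 : ∀ S : Finset (Q ⊕ R), 5 * S.card ≤ 2 * s0 →
      2 * S.card ≤ (S.biUnion fun x => univ.image (f3 x)).card) :
    ∃ (V : Type) (H : Finset (Finset V)) (c : Fin s → Finset (Finset V)),
      Good_s1 H (r0 + s) ∧ Chunked H s D c ∧
      H.card ≤ (2 + b) * H0.card + (r0 + s) * b3 * D' + G.card * D := by
  classical
  let lab : Q ⊕ R → Fin s × Fin D → Fin s → Fin s := fun i u v =>
    Sum.elim (fun q => pos q u) (fun _ => v) i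
  let edge : Finset V0 → Q ⊕ R → Finset (V0 ⊕ ((Q ⊕ R) × Fin s)) := fun h i =>
    h.disjSum ({i} ×ˢ univ)
  let word : Fin s × Fin D → Fin s → Finset (V0 ⊕ ((Q ⊕ R) × Fin s)) := fun u v =>
    (∅ : Finset V0).disjSum (univ.image fun i => (i, lab i u v))
  have edge_card : ∀ h i, (edge h i).card = h.card + s := by
    intro h i; simp [edge, card_disjSum]
  have word_card : ∀ u v, (word u v).card = r0 + s := by
    intro u v
    simp only [word, card_disjSum, card_empty, zero_add]
    rw [card_image_of_injective, card_univ, Fintype.card_sum, hQR]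
    intro i j hij
    exact (Prod.mk.inj hij).1
  have edge_l : ∀ h i x, Sum.inl x ∈ edge h i ↔ x ∈ h := by
    intro h i x; simp [edge]
  have edge_r : ∀ h i p, Sum.inr p ∈ edge h i ↔ p.1 = i := by
    intro h i p; simp only [edge, inr_mem_disjSum, mem_product, mem_singleton, mem_univ, and_true]
  have word_l : ∀ u v x, Sum.inl x ∉ word u v := by
    intro u v x; simp [word]
  have word_r : ∀ u v p, Sum.inr p ∈ word u v ↔ p.2 = lab p.1 u v := by
    rintro u v ⟨i, y⟩
    simp only [word, inr_mem_disjSum, mem_image, mem_univ, true_and, Prod.mk.injEq]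
    constructor
    · rintro ⟨_, rfl, rfl⟩; rfl
    · rintro h; exact ⟨i, rfl, h.symm⟩
  clear_value edge word
  let HA := (H0 ×ˢ (univ : Finset Bool)).image fun p => edge p.1 (Sum.inl (α (π p.1, p.2)))
  let HB := (H0 ×ˢ (univ : Finset (Fin b))).image fun p => edge p.1 (Sum.inr (f2 (π p.1) p.2))
  let HC := (univ : Finset ((Q ⊕ R) × Fin b3)).biUnion fun p =>
    (c0 (f3 p.1 p.2)).image fun h => edge h p.1
  let K := (G ×ˢ (univ : Finset (Fin D))).image fun p => word (p.1.1, p.2) p.1.2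
  let H := HA ∪ HB ∪ HC ∪ K
  have hA : ∀ h ∈ H0, ∀ β, edge h (Sum.inl (α (π h, β))) ∈ H := by
    intro h hh β
    simp only [H, mem_union]
    left; left; left
    exact mem_image.2 ⟨(h, β), by simp [hh], rfl⟩
  have hB : ∀ h ∈ H0, ∀ κ, edge h (Sum.inr (f2 (π h) κ)) ∈ H := by
    intro h hh β
    simp only [H, mem_union]
    left; left; right
    exact mem_image.2 ⟨(h, β), by simp [hh], rfl⟩
  have hC : ∀ i κ, ∀ h ∈ c0 (f3 i κ), edge h i ∈ H := by
    intro i κ h hh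
    simp only [H, mem_union]
    left; right
    exact mem_biUnion.2 ⟨(i, κ), mem_univ _, mem_image.2 ⟨h, hh, rfl⟩⟩
  have hK : ∀ a v i, (a, v) ∈ G → word (a, i) v ∈ H := by
    intro a v i hav
    simp only [H, mem_union]
    right
    exact mem_image.2 ⟨((a, v), i), by simp [hav], rfl⟩
  have hform : ∀ e ∈ H, (∃ h ∈ H0, ∃ i, e = edge h i) ∨ ∃ u v, e = word u v := by
    intro e he
    simp only [H, mem_union] at he
    rcases he with ((he | he) | he) | he
    · obtain ⟨p, hp, rfl⟩ := mem_image.1 he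
      exact Or.inl ⟨p.1, (mem_product.1 hp).1, _, rfl⟩
    · obtain ⟨p, hp, rfl⟩ := mem_image.1 he
      exact Or.inl ⟨p.1, (mem_product.1 hp).1, _, rfl⟩
    · obtain ⟨p, hp, he⟩ := mem_biUnion.1 he
      obtain ⟨h, hh, rfl⟩ := mem_image.1 he
      exact Or.inl ⟨h, hc.sub _ hh, _, rfl⟩
    · obtain ⟨p, hp, rfl⟩ := mem_image.1 he
      exact Or.inr ⟨_, _, rfl⟩
  have hHcard : H.card ≤ (2 + b) * H0.card + (r0 + s) * b3 * D' + G.card * D := by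
    have h1 : HA.card ≤ H0.card * 2 := by
      refine card_image_le.trans ?_
      simp [card_product]
    have h2 : HB.card ≤ H0.card * b := by
      refine card_image_le.trans ?_
      simp [card_product]
    have h3 : HC.card ≤ (r0 + s) * b3 * D' := by
      refine (card_biUnion_le_card_mul _ _ D' ?_).trans ?_
      · intro p _
        exact card_image_le.trans (hc.card_le _)
      · simp [Fintype.card_prod, Fintype.card_sum, hQR]
    have h4 : K.card ≤ G.card * D := by
      refine card_image_le.trans ?_
      simp [card_product]
    have h5 : H.card ≤ HA.card + HB.card + HC.card + K.card := by
      refine (card_union_le _ _).trans ?_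
      gcongr
      refine (card_union_le _ _).trans ?_
      gcongr
      exact card_union_le _ _
    nlinarith
  clear_value H
  refine ⟨_, H, fun a => univ.image fun i => word (a, i) a, ⟨?_, ?_, ?_⟩, ⟨?_, ?_, ?_⟩, hHcard⟩
  · intro e he
    rcases hform e he with ⟨h, hh, i, rfl⟩ | ⟨u, v, rfl⟩
    · rw [edge_card, hg.unif h hh]
    · exact word_card _ _
  · intro e he f hf
    rcases hform e he with ⟨h, hh, i, rfl⟩ | ⟨u, v, rfl⟩ <;>
    rcases hform f hf with ⟨h', hh', i', rfl⟩ | ⟨u', v', rfl⟩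
    · obtain ⟨x, hx, hx'⟩ := hg.inter h hh h' hh'
      exact ⟨Sum.inl x, (edge_l _ _ _).2 hx, (edge_l _ _ _).2 hx'⟩
    · exact ⟨Sum.inr (i, lab i u' v'), (edge_r _ _ _).2 rfl, (word_r _ _ _).2 rfl⟩
    · exact ⟨Sum.inr (i', lab i' u v), (word_r _ _ _).2 rfl, (edge_r _ _ _).2 rfl⟩
    · obtain ⟨q, hq⟩ := agree u u'
      exact ⟨Sum.inr (Sum.inl q, pos q u), (word_r _ _ _).2 rfl, (word_r _ _ _).2 hq⟩
  · intro T hT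
    by_contra hlt
    push Not at hlt
    set T0 := T.toLeft with hT0
    set T' := T.toRight with hT'
    have hcard : T0.card + T'.card = T.card := card_toLeft_add_card_toRight
    let T1 : Finset (Q × Fin s) := univ.filter fun p => (Sum.inl p.1, p.2) ∈ T'
    let T2 : Finset (R × Fin s) := univ.filter fun p => (Sum.inr p.1, p.2) ∈ T'
    have mT1 : ∀ q y, (q, y) ∈ T1 ↔ (Sum.inl q, y) ∈ T' := by intro q y; simp [T1]
    have mT2 : ∀ q y, (q, y) ∈ T2 ↔ (Sum.inr q, y) ∈ T' := by intro q y; simp [T2]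
    have hT12 : T1.card + T2.card ≤ T'.card := by
      have i1 : Function.Injective (fun p : Q × Fin s => ((Sum.inl p.1, p.2) : (Q ⊕ R) × Fin s)) := by
        rintro ⟨a, b⟩ ⟨c, d⟩ h; simpa using h
      have i2 : Function.Injective (fun p : R × Fin s => ((Sum.inr p.1, p.2) : (Q ⊕ R) × Fin s)) := by
        rintro ⟨a, b⟩ ⟨c, d⟩ h; simpa using h
      rw [← card_image_of_injective T1 i1, ← card_image_of_injective T2 i2, ← card_union_of_disjoint]
      · apply card_le_card
        intro p hp
        rw [mem_union] at hp
        rcases hp with hp | hp <;> obtain ⟨⟨q, y⟩, hq, rfl⟩ := mem_image.1 hp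
        · exact (mT1 _ _).1 hq
        · exact (mT2 _ _).1 hq
      · rw [disjoint_left]
        intro p hp hp'
        obtain ⟨⟨q, y⟩, hq, rfl⟩ := mem_image.1 hp
        obtain ⟨⟨q', y'⟩, hq', h⟩ := mem_image.1 hp'
        simp at h
    have cedge : ∀ h i, edge h i ∈ H → (∀ x ∈ h, x ∉ T0) → ∃ y, (i, y) ∈ T' := by
      intro h i hh hno
      obtain ⟨x, hx, hxT⟩ := hT _ hh
      rcases x with x | ⟨i', y⟩
      · exact absurd (mem_toLeft.2 hxT) (hno x ((edge_l _ _ _).1 hx))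
      · have : i' = i := (edge_r _ _ _).1 hx
        subst this
        exact ⟨y, mem_toRight.2 hxT⟩
    have cword : ∀ a v, (a, v) ∈ G → ∀ i, (∃ q, (q, pos q (a, i)) ∈ T1) ∨ ∃ ρ, (ρ, v) ∈ T2 := by
      intro a v hav i
      obtain ⟨x, hx, hxT⟩ := hT _ (hK a v i hav)
      rcases x with x | ⟨q | ρ, y⟩
      · exact absurd hx (word_l _ _ _)
      · left
        have : y = pos q (a, i) := (word_r _ _ _).1 hx
        subst this
        exact ⟨q, (mT1 _ _).2 (mem_toRight.2 hxT)⟩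
      · right
        have : y = v := (word_r _ _ _).1 hx
        subst this
        exact ⟨ρ, (mT2 _ _).2 (mem_toRight.2 hxT)⟩
    have hmix := mix s D hs hD pos fib G E1 E2 T1 T2 cword
    obtain ⟨j, hj⟩ : ∃ j, T0.card + j = r0 := ⟨r0 - T0.card, by omega⟩
    have hj1 : 1 ≤ j := by omega
    let H' := H0.filter fun h => ∀ x ∈ h, x ∉ T0
    have hS : j ≤ (H'.image π).card := by
      have : Hits H0 (T0 ∪ (H'.image π).image z) := by
        intro h hh
        by_cases hm : ∀ x ∈ h, x ∉ T0
        · refine ⟨z (π h), hπ h hh, mem_union_right _ (mem_image_of_mem _ (mem_image_of_mem _ ?_))⟩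
          exact mem_filter.2 ⟨hh, hm⟩
        · push Not at hm
          obtain ⟨x, hx, hx'⟩ := hm
          exact ⟨x, hx, mem_union_left _ hx'⟩
      have h1 := hg.cov _ this
      have h2 := card_union_le T0 ((H'.image π).image z)
      have h3 : ((H'.image π).image z).card ≤ (H'.image π).card := card_image_le
      omega
    have rowsQ : (T1.image Prod.fst).card ≤ T1.card := card_image_le
    have rowsR : (T2.image Prod.fst).card ≤ T2.card := card_image_le
    rcases hmix with hm | hm
    · by_cases h5 : 5 * j ≤ 2 * Fintype.card R
      · obtain ⟨S, hSs, hSc⟩ := exists_subset_card_eq hS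
        have h1 := hf2 S (by omega)
        have h2 : (S.biUnion fun x => univ.image (f2 x)) ⊆ T2.image Prod.fst := by
          intro ρ hρ
          obtain ⟨x, hx, hρ⟩ := mem_biUnion.1 hρ
          obtain ⟨κ, -, rfl⟩ := mem_image.1 hρ
          obtain ⟨h, hh, rfl⟩ := mem_image.1 (hSs hx)
          obtain ⟨hh0, hm⟩ := mem_filter.1 hh
          obtain ⟨y, hy⟩ := cedge _ _ (hB h hh0 κ) hm
          exact mem_image.2 ⟨(_, y), (mT2 _ _).2 hy, rfl⟩
        have h3 := card_le_card h2
        omega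
      · let U : Finset (Q ⊕ R) := univ \ T'.image Prod.fst
        have hU : T0.card + 1 ≤ U.card := by
          have h1 : (T'.image Prod.fst).card ≤ T'.card := card_image_le
          have h2 : U.card = r0 + s - (T'.image Prod.fst).card := by
            simp only [U]
            rw [card_univ_sdiff, Fintype.card_sum, hQR]
          omega
        obtain ⟨U', hU', hU'c⟩ := exists_subset_card_eq (s := U) (n := (T0.card + 2) / 2) (by omega)
        have h1 := hf3 U' (by omega)
        have h2 := hc.cov T0 (U'.biUnion fun x => univ.image (f3 x)) (by
          intro w hw h hh
          by_contra hcon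
          push Not at hcon
          obtain ⟨i, hi, hw⟩ := mem_biUnion.1 hw
          obtain ⟨κ, -, rfl⟩ := mem_image.1 hw
          obtain ⟨y, hy⟩ := cedge _ _ (hC i κ h hh) hcon
          have := (mem_sdiff.1 (hU' hi)).2
          exact this (mem_image.2 ⟨_, hy, rfl⟩))
        omega
    · have h2 : ((H'.image π) ×ˢ (univ : Finset Bool)).image α ⊆ T1.image Prod.fst := by
        intro q hq
        obtain ⟨⟨x, β⟩, hx, rfl⟩ := mem_image.1 hq
        obtain ⟨h, hh, rfl⟩ := mem_image.1 (mem_product.1 hx).1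
        obtain ⟨hh0, hm⟩ := mem_filter.1 hh
        obtain ⟨y, hy⟩ := cedge _ _ (hA h hh0 β) hm
        exact mem_image.2 ⟨(_, y), (mT1 _ _).2 hy, rfl⟩
      have h3 := card_le_card h2
      rw [card_image_of_injective _ hα, card_product, card_univ, Fintype.card_bool] at h3
      omega
  · intro a e he
    obtain ⟨i, -, rfl⟩ := mem_image.1 he
    exact hK _ _ _ (hdiag a)
  · intro a
    exact card_image_le.trans (by simp)
  · intro T X hX
    have h1 : X ×ˢ (univ : Finset (Fin D)) ⊆
        T.toRight.biUnion fun p => univ.filter fun u => lab p.1 u u.1 = p.2 := by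
      rintro ⟨a, i⟩ h
      have ha := (mem_product.1 h).1
      obtain ⟨x, hx, hxT⟩ := hX a ha (word (a, i) a) (mem_image_of_mem _ (mem_univ i))
      rcases x with x | p
      · exact absurd hx (word_l _ _ _)
      · exact mem_biUnion.2 ⟨p, mem_toRight.2 hxT, mem_filter.2 ⟨mem_univ _, ((word_r _ _ _).1 hx).symm⟩⟩
    have h2 : ∀ p : (Q ⊕ R) × Fin s, (univ.filter fun u : Fin s × Fin D => lab p.1 u u.1 = p.2).card ≤ D := by
      rintro ⟨q | ρ, y⟩
      · exact fib q y
      · calc _ ≤ (({y} : Finset (Fin s)) ×ˢ (univ : Finset (Fin D))).card := by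
              apply card_le_card
              intro u hu
              have : u.1 = y := (mem_filter.1 hu).2
              exact mem_product.2 ⟨mem_singleton.2 this, mem_univ _⟩
          _ = D := by simp
    have h3 := (card_le_card h1).trans (card_biUnion_le_card_mul _ _ D (fun p _ => h2 p))
    rw [card_product, card_univ, Fintype.card_fin] at h3
    have h4 := Nat.le_of_mul_le_mul_right h3 hD
    have h5 : T.toLeft.card + T.toRight.card = T.card := card_toLeft_add_card_toRight
    omega

lemma good_base (r : ℕ) (hr : 1 ≤ r) : Good_s1 (powersetCard r (univ : Finset (Fin (2*r-1)))) r := by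
  refine ⟨fun e he => (mem_powersetCard.1 he).2, ?_, ?_⟩
  · intro e he f hf
    by_contra hcon
    push Not at hcon
    have h1 := card_union_of_disjoint (disjoint_left.2 hcon)
    have h2 := card_le_univ (e ∪ f)
    rw [(mem_powersetCard.1 he).2, (mem_powersetCard.1 hf).2] at h1
    rw [Fintype.card_fin] at h2
    omega
  · intro T hT
    by_contra hlt
    have h1 := card_compl T
    rw [Fintype.card_fin] at h1
    obtain ⟨e, he, hec⟩ := exists_subset_card_eq (s := Tᶜ) (n := r) (by omega)
    obtain ⟨x, hx, hx'⟩ := hT e (mem_powersetCard.2 ⟨subset_univ _, hec⟩)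
    exact (mem_compl.1 (he hx)) hx'

lemma base_card (r : ℕ) : (powersetCard r (univ : Finset (Fin (2*r-1)))).card ≤ 4^r := by
  rw [card_powersetCard, card_univ, Fintype.card_fin]
  calc _ ≤ 2^(2*r-1) := Nat.choose_le_two_pow _ _
    _ ≤ 2^(2*r) := Nat.pow_le_pow_right (by norm_num) (by omega)
    _ = 4^r := by rw [pow_mul]; norm_num

/-- The induction hypothesis. -/
def PP (C D' r : ℕ) : Prop :=
  ∃ (V : Type) (H : Finset (Finset V)) (s : ℕ) (c : Fin s → Finset (Finset V)),
    Good_s1 H r ∧ Chunked H s D' c ∧ 9 * r ≤ 10 * s ∧ H.card ≤ C * r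

lemma pp_base (C D' r B : ℕ) (hr : 1 ≤ r) (hrB : r ≤ B) (hC : 4^B ≤ C) (hD : 4^B ≤ D') :
    PP C D' r := by
  have h4 : 4^r ≤ 4^B := Nat.pow_le_pow_right (by norm_num) hrB
  refine ⟨_, _, r, fun _ => powersetCard r univ, good_base r hr, ⟨fun _ => subset_rfl, fun _ => ?_, ?_⟩,
    by omega, ?_⟩
  · exact (base_card r).trans (by omega)
  · intro T X hX
    rcases X.eq_empty_or_nonempty with h | ⟨i, hi⟩
    · simp [h]
    · have h1 := (good_base r hr).cov T (hX i hi)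
      have h2 := card_le_univ X
      rw [Fintype.card_fin] at h2
      omega
  · refine (base_card r).trans ?_
    nlinarith

/-- Shape of the conclusion of the expander lemma. -/
def Exp (a b : ℕ) : Prop := ∀ (A B : Type) [Fintype A] [Fintype B] [DecidableEq A]
    [DecidableEq B], Fintype.card A ≤ a * Fintype.card B →
    ∃ f : A → Fin b → B, ∀ S : Finset A, 5 * S.card ≤ 2 * Fintype.card B →
      2 * S.card ≤ (S.biUnion fun x => univ.image (f x)).card

lemma graph_exists (b s : ℕ) (hb : Exp 2 b) : ∃ G : Finset (Fin s × Fin s),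
    (∀ S : Finset (Fin s), 5 * S.card ≤ 2 * s →
      2 * S.card ≤ (univ.filter fun v => ∃ a ∈ S, (a, v) ∈ G).card) ∧
    (∀ S : Finset (Fin s), 5 * S.card ≤ 2 * s →
      2 * S.card ≤ (univ.filter fun a => ∃ v ∈ S, (a, v) ∈ G).card) ∧
    (∀ a, (a, a) ∈ G) ∧ G.card ≤ s * (2*b+1) := by
  obtain ⟨g, hg⟩ := hb (Fin s) (Fin s) (by simp; omega)
  simp only [Fintype.card_fin] at hg
  let G1 : Finset (Fin s × Fin s) := univ.image fun p : Fin s × Fin b => (p.1, g p.1 p.2)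
  let G2 : Finset (Fin s × Fin s) := univ.image fun p : Fin s × Fin b => (g p.1 p.2, p.1)
  let G3 : Finset (Fin s × Fin s) := univ.image fun a => (a, a)
  refine ⟨G1 ∪ G2 ∪ G3, ?_, ?_, ?_, ?_⟩
  · intro S hS
    refine (hg S hS).trans (card_le_card ?_)
    intro v hv
    obtain ⟨a, ha, hv⟩ := mem_biUnion.1 hv
    obtain ⟨κ, -, rfl⟩ := mem_image.1 hv
    refine mem_filter.2 ⟨mem_univ _, a, ha, ?_⟩
    exact mem_union_left _ (mem_union_left _ (mem_image.2 ⟨(a, κ), mem_univ _, rfl⟩))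
  · intro S hS
    refine (hg S hS).trans (card_le_card ?_)
    intro v hv
    obtain ⟨a, ha, hv⟩ := mem_biUnion.1 hv
    obtain ⟨κ, -, rfl⟩ := mem_image.1 hv
    refine mem_filter.2 ⟨mem_univ _, a, ha, ?_⟩
    exact mem_union_left _ (mem_union_right _ (mem_image.2 ⟨(a, κ), mem_univ _, rfl⟩))
  · intro a
    exact mem_union_right _ (mem_image.2 ⟨a, mem_univ _, rfl⟩)
  · have h1 : G1.card ≤ s * b := card_image_le.trans (by simp)
    have h2 : G2.card ≤ s * b := card_image_le.trans (by simp)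
    have h3 : G3.card ≤ s := card_image_le.trans (by simp)
    have h4 := card_union_le (G1 ∪ G2) G3
    have h5 := card_union_le G1 G2
    calc _ ≤ s * b + s * b + s := by omega
      _ = _ := by ring

lemma pp_step (C D' b b3 M E D k s r0 r : ℕ) (hb : Exp 2 b) (hb3 : Exp (2*M) b3)
    (hE : 0 < E) (hD : D = 2 * E) (hk : 0 < k) (hs : s = D * k + 1)
    (hco : ∀ d, 0 < d → d < D → Nat.Coprime d s)
    (hr : r = r0 + s) (hr0 : 30 ≤ r0) (hk2 : 120 * k ≤ r0) (hsr : 9 * r ≤ 10 * s)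
    (hrM : r ≤ M * r0) (hDD : D ≤ D')
    (hMb : 2 * (2 + b) * r0 ≤ r) (hC : 2 * (b3 * D' + (2*b+1) * D) ≤ C)
    (ih : PP C D' r0) : PP C D' r := by
  classical
  obtain ⟨V0, H0, s0, c0, hg, hc, hs0, hH0⟩ := ih
  obtain ⟨G, E1, E2, hdiag, hGc⟩ := graph_exists b s hb
  obtain ⟨pos, fib, agree⟩ := udesign (Fin (s + 12 * k)) E k D s hE hD hk hs hco (by simp)
  have hne : H0.Nonempty := by
    rw [nonempty_iff_ne_empty]
    rintro rfl
    have := hg.cov ∅ (by intro e he; simp at he)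
    simp at this; omega
  obtain ⟨h0, hh0⟩ := hne
  have hc0 := hg.unif h0 hh0
  let eq0 := h0.equivFinOfCardEq hc0
  have hex : ∀ h : Finset V0, ∃ i : Fin r0, h ∈ H0 → ((eq0.symm i : h0) : V0) ∈ h := by
    intro h
    by_cases hh : h ∈ H0
    · obtain ⟨x, hx, hx'⟩ := hg.inter h hh h0 hh0
      exact ⟨eq0 ⟨x, hx'⟩, fun _ => by simpa using hx⟩
    · exact ⟨⟨0, by omega⟩, fun h' => absurd h' hh⟩
  choose π hπ using hex
  obtain ⟨α⟩ : Nonempty (Fin r0 × Bool ↪ Fin (s + 12 * k)) := by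
    apply Function.Embedding.nonempty_of_card_le
    simp only [Fintype.card_prod, Fintype.card_fin, Fintype.card_bool]
    omega
  obtain ⟨f2, hf2⟩ := hb (Fin r0) (Fin (r0 - 12 * k)) (by simp; omega)
  obtain ⟨f3, hf3⟩ := hb3 (Fin (s + 12 * k) ⊕ Fin (r0 - 12 * k)) (Fin s0) (by
    simp only [Fintype.card_sum, Fintype.card_fin]
    have : M * r0 ≤ M * (2 * s0) := Nat.mul_le_mul_left _ (by omega)
    calc _ ≤ M * (2 * s0) := by omega
      _ = _ := by ring)
  rw [Fintype.card_fin] at hf3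
  obtain ⟨V, H, c, hgH, hcH, hHc⟩ := step H0 r0 s0 D' c0 hg hc hr0 hs0 s D b b3 (by omega) (by omega)
    (Fin (s + 12 * k)) (Fin (r0 - 12 * k)) (by simp; omega) (by simp; omega) pos fib agree G E1 E2
    hdiag (fun i => (eq0.symm i : h0)) π hπ α α.injective f2 hf2 f3 hf3
  rw [← hr] at hgH hHc
  refine ⟨V, H, s, c, hgH, ⟨hcH.sub, fun i => (hcH.card_le i).trans hDD, hcH.cov⟩, hsr, ?_⟩
  have h1 : 2 * ((2 + b) * H0.card) ≤ C * r := by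
    calc 2 * ((2 + b) * H0.card) ≤ 2 * ((2 + b) * (C * r0)) := by gcongr
      _ = C * (2 * (2 + b) * r0) := by ring
      _ ≤ C * r := by gcongr
  have h2 : G.card * D ≤ r * (2*b+1) * D := by
    have : s ≤ r := by omega
    calc G.card * D ≤ s * (2*b+1) * D := by gcongr
      _ ≤ _ := by gcongr
  have h3 : 2 * (r * b3 * D' + r * (2*b+1) * D) ≤ C * r := by
    calc _ = 2 * (b3 * D' + (2*b+1) * D) * r := by ring
      _ ≤ _ := by gcongr
  omega

lemma pp_all : ∃ C D', ∀ r, 1 ≤ r → PP C D' r := by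
  obtain ⟨b, hb⟩ := expander 2
  obtain ⟨M, hM⟩ : ∃ M, M = 4 * (b + 2) + 20 := ⟨_, rfl⟩
  obtain ⟨b3, hb3⟩ := expander (2 * M)
  obtain ⟨D, hD⟩ : ∃ D, D = 120 * M := ⟨_, rfl⟩
  obtain ⟨L, hL⟩ : ∃ L, L = D.factorial := ⟨_, rfl⟩
  have hL0 : 0 < L := hL ▸ Nat.factorial_pos _
  have hDL : D ∣ L := hL ▸ Nat.dvd_factorial (by omega) le_rfl
  obtain ⟨l, hl⟩ := hDL
  obtain ⟨B, hB⟩ : ∃ B, B = 30 * (M * (L + 1)) := ⟨_, rfl⟩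
  refine ⟨4^B + 2 * (b3 * (D + 4^B) + (2*b+1) * D), D + 4^B, ?_⟩
  intro r
  induction r using Nat.strong_induction_on with
  | _ r ih =>
    intro hr
    by_cases hrB : r ≤ B
    · exact pp_base _ _ r B hr hrB (by omega) (by omega)
    push Not at hrB
    have hMpos : 0 < M := by omega
    have hML : 1 * L ≤ M * L := Nat.mul_le_mul_right _ hMpos
    rw [mul_add] at hB
    obtain ⟨m, hm⟩ : ∃ m, m = r / M + 1 := ⟨_, rfl⟩
    have hm1 : r ≤ M * m := by
      rw [hm]; exact (Nat.lt_mul_div_succ r hMpos).le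
    have hm2 : M * m ≤ r + M := by
      rw [hm, mul_add]; have := Nat.mul_div_le r M; omega
    obtain ⟨t, ht⟩ : ∃ t, t = r - m - 1 := ⟨_, rfl⟩
    have hmM : 28 * m ≤ M * m := Nat.mul_le_mul_right _ (by omega)
    have hmr : m + 1 ≤ r := by omega
    obtain ⟨w, hw⟩ : ∃ w, w = t / L := ⟨_, rfl⟩
    have hw1 : L * w ≤ t := hw ▸ Nat.mul_div_le t L
    have hw2 : t < L * w + L := by
      have := Nat.lt_mul_div_succ t hL0
      rw [← hw, mul_add] at this; omega
    obtain ⟨s, hs⟩ : ∃ s, s = L * w + 1 := ⟨_, rfl⟩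
    obtain ⟨r0, hr0⟩ : ∃ r0, r0 + s = r := ⟨r - s, by omega⟩
    have hr0m : m ≤ r0 := by omega
    have hr0m2 : r0 ≤ m + L := by omega
    have hMr0 : M * r0 ≤ M * m + M * L := by rw [← mul_add]; exact Nat.mul_le_mul_left _ hr0m2
    have hMr1 : r ≤ M * r0 := hm1.trans (Nat.mul_le_mul_left _ hr0m)
    have hMr2 : M * r0 ≤ 2 * r := by omega
    have h28 : (4 * (b + 2) + 20) * r0 ≤ 2 * r := by rw [← hM]; exact hMr2
    have hexp : (4 * (b + 2) + 20) * r0 = 2 * (2 * (2 + b) * r0) + 20 * r0 := by ring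
    have h30 : 30 < r0 := by
      have : M * 30 < M * r0 := by omega
      exact Nat.lt_of_mul_lt_mul_left this
    have hsk : s = D * (l * w) + 1 := by rw [hs, hl, mul_assoc]
    have hk0 : 0 < l * w := by
      apply Nat.pos_of_ne_zero
      intro h
      rw [h] at hsk
      omega
    refine pp_step _ _ b b3 M (60 * M) D (l * w) s r0 r hb hb3 (by omega) (by omega) hk0 hsk ?_
      hr0.symm h30.le ?_ ?_ hMr1 (Nat.le_add_right _ _) ?_ (Nat.le_add_left _ _) (ih r0 (by omega) (by omega))
    · intro d hd hdD
      have : d ∣ L * w := Dvd.dvd.mul_right (hL ▸ Nat.dvd_factorial hd hdD.le) _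
      rw [hs, Nat.coprime_iff_gcd_eq_one]
      obtain ⟨x, hx⟩ := this
      rw [hx]
      simp
    · have h1 : M * (120 * (l * w)) ≤ M * r0 := by
        calc _ = D * (l * w) := by rw [hD]; ring
          _ ≤ _ := by omega
      exact Nat.le_of_mul_le_mul_left h1 hMpos
    · omega
    · omega

lemma kahn : ∃ C : ℕ, 0 < C ∧ ∀ r, 1 ≤ r → ∃ (V : Type) (H : Finset (Finset V)),
    Good_s1 H r ∧ H.card ≤ C * r := by
  obtain ⟨C, D', h⟩ := pp_all
  refine ⟨C + 1, by omega, fun r hr => ?_⟩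
  obtain ⟨V, H, s, c, hg, -, -, hc⟩ := h r hr
  exact ⟨V, H, hg, hc.trans (Nat.mul_le_mul_right _ (by omega))⟩

lemma good_nonempty {V : Type} {H : Finset (Finset V)} {r : ℕ} (hr : 1 ≤ r) (hg : Good_s1 H r) :
    H.Nonempty := by
  rw [nonempty_iff_ne_empty]
  rintro rfl
  have := hg.cov ∅ (by intro e he; simp at he)
  simp at this; omega

lemma transfer {V : Type} (H : Finset (Finset V)) (r n : ℕ) (hr : 1 ≤ r) (hg : Good_s1 H r)
    (U : Finset V) (hU : ∀ e ∈ H, e ⊆ U) (hn : U.card ≤ n) :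
    ∃ H' : Finset (Finset (Fin n)), Good_s1 H' r ∧ H'.card ≤ H.card := by
  classical
  obtain ⟨e0, he0⟩ := good_nonempty hr hg
  have hn0 : 0 < n := by
    have h1 := card_le_card (hU e0 he0)
    rw [hg.unif e0 he0] at h1
    omega
  obtain ⟨f⟩ : Nonempty (U ↪ Fin n) := by
    apply Function.Embedding.nonempty_of_card_le
    simpa using hn
  let g : V → Fin n := fun x => if h : x ∈ U then f ⟨x, h⟩ else ⟨0, hn0⟩
  have hginj : ∀ x ∈ U, ∀ y ∈ U, g x = g y → x = y := by
    intro x hx y hy h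
    simp only [g, hx, hy, dif_pos] at h
    simpa using f.injective h
  refine ⟨H.image fun e => e.image g, ⟨?_, ?_, ?_⟩, card_image_le⟩
  · intro e' he'
    obtain ⟨e, he, rfl⟩ := mem_image.1 he'
    rw [card_image_of_injOn, hg.unif e he]
    intro x hx y hy h
    exact hginj x (hU e he hx) y (hU e he hy) h
  · intro f hf f' hf'
    obtain ⟨e, he, rfl⟩ := mem_image.1 hf
    obtain ⟨e', he', rfl⟩ := mem_image.1 hf'
    obtain ⟨x, hx, hx'⟩ := hg.inter e he e' he'
    exact ⟨g x, mem_image_of_mem _ hx, mem_image_of_mem _ hx'⟩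
  · intro T hT
    have h1 : Hits H (U.filter fun x => g x ∈ T) := by
      intro e he
      obtain ⟨y, hy, hyT⟩ := hT _ (mem_image_of_mem _ he)
      obtain ⟨x, hx, rfl⟩ := mem_image.1 hy
      exact ⟨x, hx, mem_filter.2 ⟨hU e he hx, hyT⟩⟩
    refine (hg.cov _ h1).trans ?_
    apply card_le_card_of_injOn g
    · intro x hx
      exact (mem_filter.1 hx).2
    · intro x hx y hy h
      exact hginj x (mem_filter.1 hx).1 y (mem_filter.1 hy).1 h

lemma final_of_good {V : Type} (H : Finset (Finset V)) (r n : ℕ) (hr : 1 ≤ r) (hg : Good_s1 H r)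
    (U : Finset V) (hU : ∀ e ∈ H, e ⊆ U) (hn : U.card ≤ n) (X : ℝ) (hX : (H.card : ℝ) ≤ X) :
    ∃ H : Finset (Finset (Fin n)),
      (∀ e ∈ H, e.card = r) ∧ (∀ e ∈ H, ∀ f ∈ H, (e ∩ f).Nonempty) ∧ coverNumber H = r ∧
      (H.card : ℝ) ≤ X := by
  obtain ⟨H', hg', hc⟩ := transfer H r n hr hg U hU hn
  have hmeet : ∀ e ∈ H', ∀ f ∈ H', (e ∩ f).Nonempty := by
    intro e he f hf
    obtain ⟨x, hx, hx'⟩ := hg'.inter e he f hf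
    exact ⟨x, mem_inter.2 ⟨hx, hx'⟩⟩
  refine ⟨H', hg'.unif, hmeet, ?_, le_trans (by exact_mod_cast hc) hX⟩
  obtain ⟨e0, he0⟩ := good_nonempty hr hg'
  have hmem : r ∈ {k | ∃ T : Finset (Fin n), T.card = k ∧ ∀ e ∈ H', (e ∩ T).Nonempty} :=
    ⟨e0, hg'.unif _ he0, fun e he => hmeet e he e0 he0⟩
  apply le_antisymm
  · exact Nat.sInf_le hmem
  · apply le_csInf ⟨r, hmem⟩
    rintro k ⟨T, rfl, hT⟩
    apply hg'.cov
    intro e he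
    obtain ⟨x, hx⟩ := hT e he
    exact ⟨x, (mem_inter.1 hx).1, (mem_inter.1 hx).2⟩

lemma comp {V : Type} (H : Finset (Finset V)) (k r1 : ℕ) (hr1 : 1 ≤ r1) (hg : Good_s1 H k)
    (U : Finset V) (hU : ∀ e ∈ H, e ⊆ U) :
    ∃ (W : Type) (H' : Finset (Finset W)) (U' : Finset W), Good_s1 H' (r1 * k) ∧
      (∀ e ∈ H', e ⊆ U') ∧ U'.card ≤ 2 * r1 * U.card ∧ H'.card ≤ 4^r1 * H.card^(2*r1-1) := by
  classical
  let I := Fin (2*r1-1)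
  let H' : Finset (Finset (Σ _ : I, V)) :=
    ((powersetCard r1 (univ : Finset I)) ×ˢ Fintype.piFinset (fun _ : I => H)).image
      fun p => p.1.sigma p.2
  have hmem : ∀ e, e ∈ H' ↔ ∃ (S : Finset I) (φ : I → Finset V), S.card = r1 ∧ (∀ i, φ i ∈ H) ∧
      S.sigma φ = e := by
    intro e
    simp only [H', mem_image, mem_product, mem_powersetCard, Fintype.mem_piFinset, Prod.exists]
    constructor
    · rintro ⟨S, φ, ⟨⟨-, h1⟩, h2⟩, h3⟩; exact ⟨S, φ, h1, h2, h3⟩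
    · rintro ⟨S, φ, h1, h2, h3⟩; exact ⟨S, φ, ⟨⟨subset_univ _, h1⟩, h2⟩, h3⟩
  refine ⟨_, H', (univ : Finset I).sigma (fun _ => U), ⟨?_, ?_, ?_⟩, ?_, ?_, ?_⟩
  · intro e he
    obtain ⟨S, φ, h1, h2, rfl⟩ := (hmem e).1 he
    rw [card_sigma, sum_congr rfl (fun i _ => hg.unif _ (h2 i)), sum_const, h1, smul_eq_mul]
  · intro e he f hf
    obtain ⟨S, φ, h1, h2, rfl⟩ := (hmem e).1 he
    obtain ⟨S', φ', h1', h2', rfl⟩ := (hmem f).1 hf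
    obtain ⟨i, hi, hi'⟩ : ∃ i ∈ S, i ∈ S' :=
      (good_base r1 hr1).inter S (mem_powersetCard.2 ⟨subset_univ _, h1⟩) S'
        (mem_powersetCard.2 ⟨subset_univ _, h1'⟩)
    obtain ⟨x, hx, hx'⟩ := hg.inter _ (h2 i) _ (h2' i)
    exact ⟨⟨i, x⟩, mem_sigma.2 ⟨hi, hx⟩, mem_sigma.2 ⟨hi', hx'⟩⟩
  · intro T hT
    by_cases hne : H.Nonempty
    swap
    · have : k = 0 := by
        have := hg.cov ∅ (by
          intro e he
          exact absurd ⟨e, he⟩ hne)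
        simpa using this
      rw [this]; simp
    obtain ⟨e0, he0⟩ := hne
    let Ti : I → Finset V := fun i => (T.filter fun p => p.1 = i).image fun p => p.2
    let S : Finset I := univ.filter fun i => Hits H (Ti i)
    have hS : r1 ≤ S.card := by
      apply (good_base r1 hr1).cov
      intro A hA
      by_contra hcon
      push Not at hcon
      have hex : ∀ i : I, ∃ e ∈ H, i ∈ A → ∀ x ∈ e, x ∉ Ti i := by
        intro i
        by_cases hi : i ∈ A
        · have h1 : ¬ Hits H (Ti i) := fun h => hcon i hi (mem_filter.2 ⟨mem_univ _, h⟩)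
          simp only [Hits] at h1
          push Not at h1
          obtain ⟨e, he, h⟩ := h1
          exact ⟨e, he, fun _ => h⟩
        · exact ⟨e0, he0, fun h => absurd h hi⟩
      choose φ hφ1 hφ2 using hex
      obtain ⟨⟨i, x⟩, hx, hxT⟩ := hT (A.sigma φ)
        ((hmem _).2 ⟨A, φ, (mem_powersetCard.1 hA).2, hφ1, rfl⟩)
      obtain ⟨hi, hx⟩ := mem_sigma.1 hx
      exact hφ2 i hi x hx (mem_image.2 ⟨⟨i, x⟩, mem_filter.2 ⟨hxT, rfl⟩, rfl⟩)
    calc r1 * k ≤ S.card * k := Nat.mul_le_mul_right _ hS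
      _ = ∑ i ∈ S, k := by simp
      _ ≤ ∑ i ∈ S, (T.filter fun p => p.1 = i).card := by
          apply sum_le_sum
          intro i hi
          exact (hg.cov _ (mem_filter.1 hi).2).trans card_image_le
      _ ≤ ∑ i, (T.filter fun p => p.1 = i).card :=
          sum_le_sum_of_subset (subset_univ _)
      _ = T.card := (card_eq_sum_card_fiberwise (fun _ _ => mem_coe.2 (mem_univ _))).symm
  · intro e he
    obtain ⟨S, φ, h1, h2, rfl⟩ := (hmem e).1 he
    exact sigma_mono (subset_univ _) (fun i => hU _ (h2 i))
  · rw [card_sigma, sum_const, smul_eq_mul, card_univ, Fintype.card_fin]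
    exact Nat.mul_le_mul_right _ (by omega)
  · refine card_image_le.trans ?_
    rw [card_product, Fintype.card_piFinset]
    simp only [prod_const, card_univ, I, Fintype.card_fin]
    exact Nat.mul_le_mul_right _ (base_card r1)

lemma pig {N : ℕ} (A B : Finset (Fin N)) (h : N < A.card + B.card) : ∃ x ∈ A, x ∈ B := by
  by_contra hcon
  push Not at hcon
  have h1 := card_union_of_disjoint (disjoint_left.2 hcon)
  have h2 := card_le_univ (A ∪ B)
  rw [Fintype.card_fin] at h2
  omega

lemma plus {V : Type} (H : Finset (Finset V)) (R s : ℕ) (hR : 1 ≤ R) (hg : Good_s1 H R)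
    (U : Finset V) (hU : ∀ e ∈ H, e ⊆ U) :
    ∃ (W : Type) (H' : Finset (Finset W)) (U' : Finset W), Good_s1 H' (R + s) ∧
      (∀ e ∈ H', e ⊆ U') ∧ U'.card ≤ U.card + (R + 2 * s - 1) ∧
      H'.card ≤ H.card * (R + 2 * s - 1).choose s + (R + 2 * s - 1).choose (R + s) := by
  classical
  let X := Fin (R + 2 * s - 1)
  let HA : Finset (Finset (V ⊕ X)) := (H ×ˢ powersetCard s (univ : Finset X)).image
    fun p => p.1.disjSum p.2
  let HB : Finset (Finset (V ⊕ X)) := (powersetCard (R+s) (univ : Finset X)).image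
    fun g => (∅ : Finset V).disjSum g
  have hmem : ∀ e, e ∈ HA ∪ HB ↔ (∃ h ∈ H, ∃ f : Finset X, f.card = s ∧ h.disjSum f = e) ∨
      ∃ g : Finset X, g.card = R + s ∧ (∅ : Finset V).disjSum g = e := by
    intro e
    simp only [HA, HB, mem_union, mem_image, mem_product, mem_powersetCard, Prod.exists,
      subset_univ, true_and]
    constructor
    · rintro (⟨h, f, ⟨h1, h2⟩, h3⟩ | h)
      · exact Or.inl ⟨h, h1, f, h2, h3⟩
      · exact Or.inr h
    · rintro (⟨h, h1, f, h2, h3⟩ | h)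
      · exact Or.inl ⟨h, f, ⟨h1, h2⟩, h3⟩
      · exact Or.inr h
  refine ⟨_, HA ∪ HB, U.disjSum univ, ⟨?_, ?_, ?_⟩, ?_, ?_, ?_⟩
  · intro e he
    rcases (hmem e).1 he with ⟨h, hh, f, hf, rfl⟩ | ⟨g, hg, rfl⟩
    · rw [card_disjSum, hg.unif h hh, hf]
    · rw [card_disjSum, hg]; simp
  · intro e he e' he'
    rcases (hmem e).1 he with ⟨h, hh, f, hf, rfl⟩ | ⟨g, hg', rfl⟩ <;>
    rcases (hmem e').1 he' with ⟨h', hh', f', hf', rfl⟩ | ⟨g', hg'', rfl⟩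
    · obtain ⟨x, hx, hx'⟩ := hg.inter h hh h' hh'
      exact ⟨Sum.inl x, by simpa using hx, by simpa using hx'⟩
    · obtain ⟨x, hx, hx'⟩ := pig f g' (by omega)
      exact ⟨Sum.inr x, by simpa using hx, by simpa using hx'⟩
    · obtain ⟨x, hx, hx'⟩ := pig g f' (by omega)
      exact ⟨Sum.inr x, by simpa using hx, by simpa using hx'⟩
    · obtain ⟨x, hx, hx'⟩ := pig g g' (by omega)
      exact ⟨Sum.inr x, by simpa using hx, by simpa using hx'⟩
  · intro T hT
    have hcard : T.toLeft.card + T.toRight.card = T.card := card_toLeft_add_card_toRight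
    have hcompl := card_compl T.toRight
    rw [Fintype.card_fin] at hcompl
    have h1 : s ≤ T.toRight.card := by
      by_contra hlt
      obtain ⟨g, hgs, hgc⟩ := exists_subset_card_eq (s := T.toRightᶜ) (n := R + s) (by omega)
      obtain ⟨x, hx, hxT⟩ := hT _ ((hmem _).2 (Or.inr ⟨g, hgc, rfl⟩))
      rcases x with x | x
      · simp at hx
      · rw [inr_mem_disjSum] at hx
        exact (mem_compl.1 (hgs hx)) (mem_toRight.2 hxT)
    by_cases hH : Hits H T.toLeft
    · have := hg.cov _ hH
      omega
    · by_contra hlt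
      obtain ⟨f, hfs, hfc⟩ := exists_subset_card_eq (s := T.toRightᶜ) (n := s) (by omega)
      simp only [Hits] at hH
      push Not at hH
      obtain ⟨h, hh, hno⟩ := hH
      obtain ⟨x, hx, hxT⟩ := hT _ ((hmem _).2 (Or.inl ⟨h, hh, f, hfc, rfl⟩))
      rcases x with x | x
      · rw [inl_mem_disjSum] at hx
        exact hno x hx (mem_toLeft.2 hxT)
      · rw [inr_mem_disjSum] at hx
        exact (mem_compl.1 (hfs hx)) (mem_toRight.2 hxT)
  · intro e he
    rcases (hmem e).1 he with ⟨h, hh, f, hf, rfl⟩ | ⟨g, hg, rfl⟩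
    · exact disjSum_mono (hU h hh) (subset_univ _)
    · exact disjSum_mono (empty_subset _) (subset_univ _)
  · rw [card_disjSum, card_univ, Fintype.card_fin]
  · refine (card_union_le _ _).trans (add_le_add (card_image_le.trans ?_) (card_image_le.trans ?_))
    · rw [card_product, card_powersetCard, card_univ, Fintype.card_fin]
    · rw [card_powersetCard, card_univ, Fintype.card_fin]

lemma choose_bd (k m s r1 : ℕ) (hk : 1 ≤ k) (hs : s ≤ r1) (hm : m ≤ 3 * k * r1) :
    m.choose s ≤ (27 * k)^r1 := by
  have hk' : (1:ℝ) ≤ k := by exact_mod_cast hk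
  have h1 : (m.choose s : ℝ) * (1/k:ℝ)^s ≤ (1 + 1/k)^m := by
    by_cases hsm : s ≤ m
    · rw [add_comm, add_pow]
      have := single_le_sum (f := fun i => (1/k:ℝ)^i * 1^(m-i) * (m.choose i : ℝ))
        (s := range (m+1)) (fun i _ => by positivity) (mem_range.2 (by omega : s < m+1))
      simp only [one_pow, mul_one] at this ⊢
      linarith
    · rw [Nat.choose_eq_zero_of_lt (by omega)]
      simp; positivity
  have h2 : (1 + 1/k:ℝ)^k ≤ 3 := by
    calc (1 + 1/k:ℝ)^k ≤ (Real.exp (1/k))^k := by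
          gcongr
          rw [add_comm]; exact Real.add_one_le_exp _
      _ = Real.exp 1 := by
          rw [← Real.exp_nat_mul]; congr 1; field_simp
      _ ≤ 3 := Real.exp_one_lt_three.le
  have h3 : (1 + 1/k:ℝ)^m ≤ 27^r1 := by
    calc (1 + 1/k:ℝ)^m ≤ (1 + 1/k:ℝ)^(3 * k * r1) := by
          apply pow_le_pow_right₀ _ hm
          have : (0:ℝ) ≤ 1/k := by positivity
          linarith
      _ = (((1 + 1/k:ℝ)^k)^3)^r1 := by
          rw [← pow_mul, ← pow_mul]; congr 1; ring
      _ ≤ (3^3)^r1 := by gcongr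
      _ = 27^r1 := by norm_num
  have h4 : (m.choose s : ℝ) ≤ (27 * k)^r1 := by
    have h5 : (m.choose s : ℝ) = ((m.choose s : ℝ) * (1/k:ℝ)^s) * k^s := by
      rw [mul_assoc, ← mul_pow, one_div, inv_mul_cancel₀ (by positivity), one_pow, mul_one]
    rw [h5, mul_pow]
    gcongr
    exact h1.trans h3
  exact_mod_cast h4

lemma used_card {V : Type} (H : Finset (Finset V)) (k c : ℕ) (hg : Good_s1 H k)
    (hc : H.card ≤ c) : ∃ U : Finset V, (∀ e ∈ H, e ⊆ U) ∧ U.card ≤ c * k := by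
  classical
  refine ⟨H.biUnion id, fun e he => subset_biUnion_of_mem id he, ?_⟩
  refine (card_biUnion_le_card_mul _ _ k (fun e he => (hg.unif e he).le)).trans ?_
  exact Nat.mul_le_mul_right _ hc

/-- The intermediate range. -/
lemma middle (C0 r n : ℕ) (hC0 : 0 < C0) (hr : 2 ≤ r)
    (hK : ∀ r, 1 ≤ r → ∃ (V : Type) (H : Finset (Finset V)), Good_s1 H r ∧ H.card ≤ C0 * r)
    (h1 : (216 * C0^2) * r ≤ n) (h2 : n ≤ C0 * r^2) :
    ∃ (r1 : ℕ) (W : Type) (H : Finset (Finset W)) (U : Finset W), Good_s1 H r ∧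
      (∀ e ∈ H, e ⊆ U) ∧ U.card ≤ n ∧ n * r1 ≤ 5 * C0 * r^2 ∧
      (H.card : ℝ) ≤ ((n:ℝ)/r)^(4 * r1) := by
  have hn : 0 < n := by
    have : 0 < 216 * C0^2 * r := by positivity
    omega
  obtain ⟨r1, hr1⟩ : ∃ r1, r1 = 4 * C0 * r^2 / n + 1 := ⟨_, rfl⟩
  have hb1 : 4 * C0 * r^2 ≤ n * r1 := hr1 ▸ (Nat.lt_mul_div_succ _ hn).le
  have hb2 : n * r1 ≤ 5 * C0 * r^2 := by
    rw [hr1, mul_add]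
    have := Nat.mul_div_le (4 * C0 * r^2) n
    have e : 5 * C0 * r^2 = 4 * C0 * r^2 + C0 * r^2 := by ring
    omega
  have hr1pos : 1 ≤ r1 := hr1 ▸ Nat.le_add_left _ _
  have hr1r : r1 ≤ r := by
    have : (216 * C0^2 * r) * r1 ≤ 5 * C0 * r^2 := (Nat.mul_le_mul_right _ h1).trans hb2
    have h3 : C0 * r * (216 * C0 * r1) ≤ C0 * r * (5 * r) := by nlinarith
    have h4 := Nat.le_of_mul_le_mul_left h3 (by positivity)
    nlinarith
  obtain ⟨k, hk⟩ : ∃ k, k = r / r1 := ⟨_, rfl⟩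
  obtain ⟨s, hs⟩ : ∃ s, s = r % r1 := ⟨_, rfl⟩
  have hks : r1 * k + s = r := by rw [hk, hs]; exact Nat.div_add_mod r r1
  have hsr1 : s < r1 := hs ▸ Nat.mod_lt _ hr1pos
  have hk1 : 1 ≤ k := hk ▸ Nat.div_pos hr1r hr1pos
  have hR1 : 1 ≤ r1 * k := Nat.mul_pos hr1pos hk1
  obtain ⟨V, H, hg, hHc⟩ := hK k hk1
  obtain ⟨U, hU, hUc⟩ := used_card H k _ hg hHc
  obtain ⟨W1, H1, U1, hg1, hU1, hU1c, hH1c⟩ := comp H k r1 hr1pos hg U hU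
  obtain ⟨W2, H2, U2, hg2, hU2, hU2c, hH2c⟩ := plus H1 (r1 * k) s hR1 hg1 U1 hU1
  rw [hks] at hg2
  have hm : r1 * k + 2 * s - 1 ≤ 3 * k * r1 := by
    have e1 : 3 * k * r1 = 3 * (r1 * k) := by ring
    have e2 : r1 * 1 ≤ r1 * k := Nat.mul_le_mul_left _ hk1
    omega
  have hcount : H2.card ≤ (216 * C0^2 * k^3)^r1 := by
    have c1 := choose_bd k (r1 * k + 2 * s - 1) s r1 hk1 hsr1.le hm
    have c2 : (r1 * k + 2 * s - 1).choose (r1 * k + s) ≤ (27 * k)^r1 := by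
      rcases Nat.eq_zero_or_pos s with h | h
      · rw [h, Nat.choose_eq_zero_of_lt (by omega)]; simp
      · rw [← Nat.choose_symm (by omega)]
        exact choose_bd k (r1 * k + 2 * s - 1) _ r1 hk1 (by omega) hm
    have c3 : H.card^(2*r1-1) ≤ ((C0 * k)^2)^r1 := by
      rw [← pow_mul]
      calc H.card^(2*r1-1) ≤ (C0*k)^(2*r1-1) := Nat.pow_le_pow_left hHc _
        _ ≤ (C0*k)^(2*r1) := Nat.pow_le_pow_right (Nat.mul_pos hC0 hk1) (by omega)
    have c4 : 1 ≤ 4^r1 * ((C0 * k)^2)^r1 := by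
      have : 0 < 4^r1 * ((C0 * k)^2)^r1 := by positivity
      omega
    have c5 : H1.card ≤ 4^r1 * ((C0 * k)^2)^r1 := hH1c.trans (Nat.mul_le_mul_left _ c3)
    have c6 : 2 ≤ 2^r1 := by
      calc 2 = 2^1 := by norm_num
        _ ≤ 2^r1 := Nat.pow_le_pow_right (by norm_num) hr1pos
    calc H2.card ≤ H1.card * (27*k)^r1 + (27*k)^r1 :=
          hH2c.trans (add_le_add (Nat.mul_le_mul_left _ c1) c2)
      _ ≤ (4^r1 * ((C0 * k)^2)^r1) * (27*k)^r1 + (4^r1 * ((C0 * k)^2)^r1) * (27*k)^r1 := by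
          apply add_le_add
          · exact Nat.mul_le_mul_right _ c5
          · exact Nat.le_mul_of_pos_left _ c4
      _ = 2 * ((4^r1 * ((C0 * k)^2)^r1) * (27*k)^r1) := by ring
      _ ≤ 2^r1 * ((4^r1 * ((C0 * k)^2)^r1) * (27*k)^r1) := Nat.mul_le_mul_right _ c6
      _ = (216 * C0^2 * k^3)^r1 := by
          rw [← mul_pow, ← mul_pow, ← mul_pow]; congr 1; ring
  have hrk : r1 * k ≤ r := by omega
  have hkr : k * r ≤ n := by
    have : r1 * (k * r) ≤ r1 * n := by
      calc r1 * (k * r) = (r1 * k) * r := by ring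
        _ ≤ r * r := Nat.mul_le_mul_right _ hrk
        _ ≤ 4 * C0 * r^2 := by nlinarith
        _ ≤ r1 * n := by rw [mul_comm r1 n]; exact hb1
    exact Nat.le_of_mul_le_mul_left this hr1pos
  refine ⟨r1, W2, H2, U2, hg2, hU2, ?_, hb2, ?_⟩
  · have v1 : 2 * U1.card ≤ n := by
      have : r1 * (4 * r1 * (C0 * k * k)) ≤ r1 * n := by
        calc r1 * (4 * r1 * (C0 * k * k)) = 4 * C0 * (r1 * k)^2 := by ring
          _ ≤ 4 * C0 * r^2 := by gcongr
          _ ≤ r1 * n := by rw [mul_comm r1 n]; exact hb1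
      have h5 := Nat.le_of_mul_le_mul_left this hr1pos
      have h6 : 2 * r1 * U.card ≤ 2 * r1 * (C0 * k * k) := Nat.mul_le_mul_left _ hUc
      calc 2 * U1.card ≤ 2 * (2 * r1 * (C0 * k * k)) := by omega
        _ = 4 * r1 * (C0 * k * k) := by ring
        _ ≤ n := h5
    have v2 : 4 * r ≤ n := by nlinarith
    omega
  · have hrr : (0:ℝ) < r := by exact_mod_cast (by omega : 0 < r)
    have x1 : (k:ℝ) ≤ (n:ℝ)/r := by
      rw [le_div_iff₀ hrr]; exact_mod_cast hkr
    have x2 : (216 * (C0:ℝ)^2) ≤ (n:ℝ)/r := by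
      rw [le_div_iff₀ hrr]; exact_mod_cast h1
    have x3 : (H2.card : ℝ) ≤ ((216 * (C0:ℝ)^2 * (k:ℝ)^3)^r1) := by
      have := (Nat.cast_le (α := ℝ)).2 hcount
      push_cast at this
      exact this
    have x4 : (216 * (C0:ℝ)^2) * (k:ℝ)^3 ≤ (n:ℝ)/r * ((n:ℝ)/r)^3 :=
      mul_le_mul x2 (pow_le_pow_left₀ (by positivity) x1 3) (by positivity) (by positivity)
    calc (H2.card : ℝ) ≤ ((216 * (C0:ℝ)^2 * (k:ℝ)^3)^r1) := x3
      _ ≤ ((n:ℝ)/r * ((n:ℝ)/r)^3)^r1 := pow_le_pow_left₀ (by positivity) x4 r1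
      _ = ((n:ℝ)/r)^(4 * r1) := by rw [pow_mul]; congr 1; ring

theorem stmt_1 :
    ∃ C : ℝ, 0 < C ∧
      ∀ r n : ℕ, 3 ≤ 2 * r - 1 → 2 * r - 1 ≤ n →
        ∃ H : Finset (Finset (Fin n)),
          (∀ e ∈ H, e.card = r) ∧ (∀ e ∈ H, ∀ f ∈ H, (e ∩ f).Nonempty) ∧ coverNumber H = r ∧
          (H.card : ℝ) ≤ max (((n : ℝ) / (r : ℝ)) ^ (C * (r : ℝ) ^ 2 / (n : ℝ))) (C * r) := by
  obtain ⟨C0, hC0, hK⟩ := kahn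
  refine ⟨4 * (216 * (C0:ℝ)^2) + 20 * C0, by positivity, ?_⟩
  intro r n hr3 hrn
  have hr : 2 ≤ r := by omega
  have hC0' : (1:ℝ) ≤ C0 := by exact_mod_cast hC0
  have hr' : (2:ℝ) ≤ r := by exact_mod_cast hr
  have hn' : (0:ℝ) < n := by exact_mod_cast (by omega : 0 < n)
  have hnr : (3/2 : ℝ) ≤ (n:ℝ)/r := by
    rw [le_div_iff₀ (by linarith)]
    have h1 : 3 * r ≤ 2 * n := by omega
    have : (3 * r : ℝ) ≤ 2 * n := by exact_mod_cast h1
    linarith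
  rcases le_total (C0 * r^2) n with hbig | hsmall
  · obtain ⟨V, H, hg, hHc⟩ := hK r (by omega)
    obtain ⟨U, hU, hUc⟩ := used_card H r _ hg hHc
    refine final_of_good H r n (by omega) hg U hU (hUc.trans (le_trans (by nlinarith) hbig)) _ ?_
    refine le_trans ?_ (le_max_right _ _)
    have : (H.card : ℝ) ≤ C0 * r := by exact_mod_cast hHc
    refine this.trans ?_
    gcongr
    nlinarith
  rcases le_total ((216 * C0^2) * r) n with hmid | hlow
  · obtain ⟨r1, W, H, U, hg, hU, hUc, hr1, hHc⟩ := middle C0 r n hC0 hr hK hmid hsmall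
    refine final_of_good H r n (by omega) hg U hU hUc _ ?_
    refine le_trans ?_ (le_max_left _ _)
    refine hHc.trans ?_
    rw [← Real.rpow_natCast]
    apply Real.rpow_le_rpow_of_exponent_le (by linarith)
    rw [le_div_iff₀ hn']
    have : (n * r1 : ℝ) ≤ 5 * C0 * r^2 := by exact_mod_cast hr1
    push_cast
    have : (0:ℝ) ≤ 4 * (216 * (C0:ℝ)^2) * r^2 := by positivity
    nlinarith
  · refine final_of_good _ r n (by omega) (good_base r (by omega)) univ (fun e _ => subset_univ _)
      (by simpa using hrn) _ ?_
    refine le_trans ?_ (le_max_left _ _)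
    have h1 : ((powersetCard r (univ : Finset (Fin (2*r-1)))).card : ℝ) ≤ (4:ℝ)^r := by
      exact_mod_cast base_card r
    refine h1.trans ?_
    have hlow' : (n:ℝ) ≤ (216 * (C0:ℝ)^2) * r := by exact_mod_cast hlow
    calc (4:ℝ)^r ≤ ((3/2:ℝ)^4)^r := by
          gcongr; norm_num
      _ = (3/2:ℝ)^(4*r) := by rw [pow_mul]
      _ ≤ ((n:ℝ)/r)^(4*r) := by gcongr
      _ = ((n:ℝ)/r)^((4*r : ℕ):ℝ) := (Real.rpow_natCast _ _).symm
      _ ≤ _ := by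
          apply Real.rpow_le_rpow_of_exponent_le (by linarith)
          rw [le_div_iff₀ hn']
          push_cast
          have : (0:ℝ) ≤ C0 * r^2 := by positivity
          nlinarith
end

section
/- Let n ≥ 2r−1 ≥ 3 be integers and let H be an n-vertex r-uniform hypergraph with cover number at least r. Then the number of edges of H is at least C(n, r−1) / C(n−r, r−1), where C(a,b) denotes the binomial coefficient. -/
open Finset

theorem stmt_2 (n r : ℕ) (h3 : 3 ≤ 2 * r - 1) (hn : 2 * r - 1 ≤ n)
    (V : Type) [Fintype V] [DecidableEq V] (hV : Fintype.card V = n)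
    (H : Finset (Finset V))
    (hunif : ∀ e ∈ H, e.card = r)
    (hcov : r ≤ coverNumber H) :
    ((n.choose (r - 1) : ℝ) / ((n - r).choose (r - 1) : ℝ)) ≤ (H.card : ℝ) := by
  have hpos : 0 < (n - r).choose (r - 1) := Nat.choose_pos (by omega)
  rw [div_le_iff₀ (by exact_mod_cast hpos)]
  -- every `(r-1)`-set misses some edge
  have hsub : (univ : Finset V).powersetCard (r - 1) ⊆
      H.biUnion (fun e => (eᶜ).powersetCard (r - 1)) := by
    intro T hT
    have hTc : T.card = r - 1 := (mem_powersetCard.mp hT).2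
    have hex : ∃ e ∈ H, ¬ (e ∩ T).Nonempty := by
      by_contra hcon
      push Not at hcon
      have hle : coverNumber H ≤ r - 1 := Nat.sInf_le ⟨T, hTc, hcon⟩
      omega
    obtain ⟨e, he, hne⟩ := hex
    refine mem_biUnion.mpr ⟨e, he, mem_powersetCard.mpr ⟨?_, hTc⟩⟩
    intro x hx
    rw [mem_compl]
    intro hxe
    exact hne ⟨x, mem_inter.mpr ⟨hxe, hx⟩⟩
  have hcard := card_le_card hsub
  rw [card_powersetCard, card_univ, hV] at hcard
  have hbound : (H.biUnion (fun e => (eᶜ).powersetCard (r - 1))).card ≤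
      H.card * (n - r).choose (r - 1) := by
    apply card_biUnion_le_card_mul
    intro e he
    rw [card_powersetCard, card_compl, hV, hunif e he]
  exact_mod_cast hcard.trans hbound
end

section
/- There exists a constant c > 0 such that for all integers n ≥ 2r−1 ≥ 3 one has C(n, r−1) / C(n−r, r−1) ≥ 2^(c·r²/n), where C(a,b) denotes the binomial coefficient. -/
theorem aux_choose (n r k : ℕ) (hr : r ≤ n) :
    (n - r).choose k * n ^ k ≤ n.choose k * (n - r) ^ k := by
  induction k with
  | zero => simp
  | succ k ih =>
    have h1 := Nat.choose_succ_right_eq (n - r) k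
    have h2 := Nat.choose_succ_right_eq n k
    have h3 : (n - r - k) * n ≤ (n - k) * (n - r) := by
      obtain ⟨m, rfl⟩ := Nat.exists_eq_add_of_le hr
      rw [Nat.add_sub_cancel_left]
      rcases le_total m k with h | h
      · simp [Nat.sub_eq_zero_of_le h]
      · obtain ⟨j, rfl⟩ := Nat.exists_eq_add_of_le h
        have e1 : k + j - k = j := by omega
        have e2 : r + (k + j) - k = r + j := by omega
        rw [e1, e2]
        nlinarith [Nat.zero_le (r * k)]
    refine Nat.le_of_mul_le_mul_right ?_ (Nat.succ_pos k)
    calc (n - r).choose (k + 1) * n ^ (k + 1) * (k + 1)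
        = ((n - r).choose (k + 1) * (k + 1)) * n ^ (k + 1) := by ring
      _ = ((n - r).choose k * n ^ k) * ((n - r - k) * n) := by rw [h1]; ring
      _ ≤ (n.choose k * (n - r) ^ k) * ((n - k) * (n - r)) := Nat.mul_le_mul ih h3
      _ = (n.choose k * (n - k)) * (n - r) ^ (k + 1) := by ring
      _ = n.choose (k + 1) * (n - r) ^ (k + 1) * (k + 1) := by rw [← h2]; ring

theorem stmt_3 :
    ∃ c : ℝ, 0 < c ∧
      ∀ n r : ℕ, 3 ≤ 2 * r - 1 → 2 * r - 1 ≤ n →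
        (2 : ℝ) ^ (c * (r : ℝ) ^ 2 / (n : ℝ)) ≤
          ((n.choose (r - 1) : ℝ) / ((n - r).choose (r - 1) : ℝ)) := by
  refine ⟨1 / 2, by norm_num, ?_⟩
  intro n r h3 hn
  obtain ⟨k, rfl⟩ : ∃ k, r = k + 1 := ⟨r - 1, by omega⟩
  have hk : 1 ≤ k := by omega
  have hkn : k + 1 ≤ n := by omega
  rw [Nat.add_sub_cancel]
  have haux := aux_choose n (k + 1) k hkn
  have hpos : 0 < (n - (k + 1)).choose k := Nat.choose_pos (by omega)
  have hposR : (0 : ℝ) < ((n - (k + 1)).choose k : ℝ) := by exact_mod_cast hpos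
  have hn0 : (0 : ℝ) < n := by exact_mod_cast (by omega : 0 < n)
  have hauxR : ((n - (k + 1)).choose k : ℝ) * (n : ℝ) ^ k ≤
      (n.choose k : ℝ) * ((n : ℝ) - ((k : ℝ) + 1)) ^ k := by
    have : (((n - (k + 1)).choose k * n ^ k : ℕ) : ℝ) ≤
      ((n.choose k * (n - (k + 1)) ^ k : ℕ) : ℝ) := by exact_mod_cast haux
    push_cast [Nat.cast_sub hkn] at this
    exact this
  have hd0 : (0 : ℝ) ≤ (n : ℝ) - ((k : ℝ) + 1) := by
    have : ((k + 1 : ℕ) : ℝ) ≤ n := by exact_mod_cast hkn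
    push_cast at this
    linarith
  have hexp : (n : ℝ) - ((k : ℝ) + 1) ≤ n * Real.exp (-(((k : ℝ) + 1) / n)) := by
    have := Real.add_one_le_exp (-(((k : ℝ) + 1) / n))
    calc (n : ℝ) - ((k : ℝ) + 1) = n * (-(((k : ℝ) + 1) / n) + 1) := by
          field_simp
          ring
      _ ≤ _ := by gcongr
  have hpow := pow_le_pow_left₀ hd0 hexp k
  rw [mul_pow, ← Real.exp_nat_mul] at hpow
  have hmain : ((n - (k + 1)).choose k : ℝ) ≤
      (n.choose k : ℝ) * Real.exp (k * -(((k : ℝ) + 1) / n)) := by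
    have hnk : (0 : ℝ) < (n : ℝ) ^ k := by positivity
    refine le_of_mul_le_mul_right ?_ hnk
    calc _ ≤ _ := hauxR
      _ ≤ (n.choose k : ℝ) * ((n : ℝ) ^ k * Real.exp (k * -(((k : ℝ) + 1) / n))) := by gcongr
      _ = _ := by ring
  have h2 : (2 : ℝ) ^ (1 / 2 * ((k + 1 : ℕ) : ℝ) ^ 2 / (n : ℝ)) ≤
      Real.exp (k * (((k : ℝ) + 1) / n)) := by
    have hk1 : (1 : ℝ) ≤ k := by exact_mod_cast hk
    rw [Real.rpow_def_of_pos (by norm_num)]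
    apply Real.exp_le_exp.mpr
    have hl : Real.log 2 ≤ 1 := by linarith [Real.log_two_lt_d9]
    calc _ ≤ 1 * (1 / 2 * ((k + 1 : ℕ) : ℝ) ^ 2 / (n : ℝ)) := by gcongr
      _ = (1 / 2 * ((k : ℝ) + 1) ^ 2) / n := by push_cast; ring
      _ ≤ (k * ((k : ℝ) + 1)) / n := by
          apply div_le_div_of_nonneg_right _ hn0.le
          nlinarith
      _ = _ := by ring
  refine h2.trans ?_
  rw [le_div_iff₀ hposR]
  calc _ ≤ Real.exp (k * (((k : ℝ) + 1) / n)) *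
        ((n.choose k : ℝ) * Real.exp (k * -(((k : ℝ) + 1) / n))) := by gcongr
    _ = (n.choose k : ℝ) * (Real.exp (k * (((k : ℝ) + 1) / n)) *
        Real.exp (k * -(((k : ℝ) + 1) / n))) := by ring
    _ = n.choose k := by rw [← Real.exp_add]; simp
end

section
/- Let H₁ be an r₁-uniform critical hypergraph and H₂ an r₂-uniform critical hypergraph. Then there exists an (r₁·r₂)-uniform critical hypergraph with exactly |V(H₁)|·|V(H₂)| vertices and exactly |E(H₁)|·|E(H₂)|^(r₁) edges. -/
open Finset

/-- An `r`-uniform hypergraph is critical if it is intersecting and its cover number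
equals `r`. -/
def Critical {V : Type*} [DecidableEq V] (r : ℕ) (H : Finset (Finset V)) : Prop :=
  (∀ e ∈ H, e.card = r) ∧ (∀ e ∈ H, ∀ f ∈ H, (e ∩ f).Nonempty) ∧ coverNumber H = r

theorem critical_of {V : Type*} [DecidableEq V] (r : ℕ) (H : Finset (Finset V))
    (hu : ∀ e ∈ H, e.card = r) (hi : ∀ e ∈ H, ∀ f ∈ H, (e ∩ f).Nonempty)
    (hc : ∀ T : Finset V, (∀ e ∈ H, (e ∩ T).Nonempty) → r ≤ T.card)
    (h0 : H = ∅ → r = 0) : Critical r H := by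
  refine ⟨hu, hi, ?_⟩
  unfold coverNumber
  have hex : r ∈ {k | ∃ T : Finset V, T.card = k ∧ ∀ e ∈ H, (e ∩ T).Nonempty} := by
    rcases H.eq_empty_or_nonempty with h | ⟨e, he⟩
    · exact ⟨∅, by simp [h0 h], by simp [h]⟩
    · exact ⟨e, hu e he, fun f hf => hi f hf e he⟩
  apply le_antisymm (Nat.sInf_le hex)
  apply le_csInf ⟨r, hex⟩
  rintro k ⟨T, rfl, hT⟩
  exact hc T hT

theorem Critical.le_cover {V : Type*} [DecidableEq V] {r : ℕ} {H : Finset (Finset V)}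
    (h : Critical r H) (T : Finset V) (hT : ∀ e ∈ H, (e ∩ T).Nonempty) : r ≤ T.card := by
  have h3 := h.2.2
  rw [← h3]
  exact Nat.sInf_le ⟨T, rfl, hT⟩

theorem Critical.eq_zero {V : Type*} [DecidableEq V] {r : ℕ} {H : Finset (Finset V)}
    (h : Critical r H) (h0 : H = ∅) : r = 0 := by
  have := h.le_cover ∅ (by simp [h0])
  simpa using this

/-- The blow-up edge: over each vertex `v` of `e` put a copy of the edge `f v`. -/
def blowEdge {V₁ V₂ W : Type*} [DecidableEq W] (φ : V₁ × V₂ ≃ W) (e : Finset V₁)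
    (f : ∀ v ∈ e, Finset V₂) : Finset W :=
  e.attach.biUnion fun v => (f v.1 v.2).image fun w => φ (v.1, w)

theorem mem_blowEdge {V₁ V₂ W : Type*} [DecidableEq W] (φ : V₁ × V₂ ≃ W) (e : Finset V₁)
    (f : ∀ v ∈ e, Finset V₂) (v : V₁) (w : V₂) :
    φ (v, w) ∈ blowEdge φ e f ↔ ∃ h : v ∈ e, w ∈ f v h := by
  unfold blowEdge
  simp only [mem_biUnion, mem_attach, true_and, mem_image,
    EmbeddingLike.apply_eq_iff_eq, Prod.mk.injEq, Subtype.exists]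
  constructor
  · rintro ⟨a, ha, b, hb, rfl, rfl⟩
    exact ⟨ha, hb⟩
  · rintro ⟨h, hw⟩
    exact ⟨v, h, w, hw, rfl, rfl⟩

theorem card_blowEdge {V₁ V₂ W : Type*} [DecidableEq W] (φ : V₁ × V₂ ≃ W) (e : Finset V₁)
    (f : ∀ v ∈ e, Finset V₂) (r : ℕ) (hf : ∀ v h, (f v h).card = r) :
    (blowEdge φ e f).card = e.card * r := by
  unfold blowEdge
  rw [card_biUnion]
  · have hc : ∀ v ∈ e.attach, ((f v.1 v.2).image fun w => φ (v.1, w)).card = r := by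
      intro v _
      rw [card_image_of_injective _ (fun a b hab => by simpa using hab), hf]
    rw [sum_congr rfl hc]
    simp
  · intro a _ b _ hab
    change Disjoint _ _
    rw [Finset.disjoint_left]
    intro x hx hy
    simp only [mem_image] at hx hy
    obtain ⟨c, _, rfl⟩ := hx
    obtain ⟨d, _, h⟩ := hy
    simp only [EmbeddingLike.apply_eq_iff_eq, Prod.mk.injEq] at h
    exact hab (Subtype.ext h.1.symm)

theorem blow_main {V₁ V₂ W : Type*} [DecidableEq V₁] [DecidableEq V₂] [DecidableEq W]
    [Fintype V₁] [Fintype V₂]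
    (φ : V₁ × V₂ ≃ W) (r₁ r₂ : ℕ) (H₁ : Finset (Finset V₁)) (H₂ : Finset (Finset V₂))
    (h₁ : Critical r₁ H₁) (h₂ : Critical r₂ H₂) :
    ∃ H : Finset (Finset W),
      Critical (r₁ * r₂) H ∧ H.card = H₁.card * H₂.card ^ r₁ := by
  classical
  set P := H₁.sigma (fun e => e.pi (fun _ => H₂)) with hP
  set H : Finset (Finset W) := P.image (fun p => blowEdge φ p.1 p.2) with hH
  have hne : ∀ e ∈ H₂, e.Nonempty := fun e he => by simpa using h₂.2.1 e he e he
  have hcard : H.card = H₁.card * H₂.card ^ r₁ := by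
    rw [hH, card_image_of_injOn, hP, card_sigma]
    · rw [Finset.sum_congr rfl (g := fun _ => H₂.card ^ r₁), sum_const, smul_eq_mul]
      intro e he
      rw [card_pi, prod_const, h₁.1 e he]
    · rintro ⟨e, f⟩ hp ⟨e', f'⟩ hq heq
      simp only [hP, coe_sigma, Set.mem_sigma_iff, mem_coe, mem_pi] at hp hq
      simp only at heq
      have key : ∀ v w, (∃ h : v ∈ e, w ∈ f v h) ↔ ∃ h : v ∈ e', w ∈ f' v h := by
        intro v w
        rw [← mem_blowEdge φ, ← mem_blowEdge φ, heq]
      have hee : e = e' := by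
        ext v
        constructor
        · intro hv
          obtain ⟨w, hw⟩ := hne _ (hp.2 v hv)
          exact ((key v w).1 ⟨hv, hw⟩).1
        · intro hv
          obtain ⟨w, hw⟩ := hne _ (hq.2 v hv)
          exact ((key v w).2 ⟨hv, hw⟩).1
      subst hee
      congr 1
      funext v hv
      ext w
      constructor
      · intro hw
        exact ((key v w).1 ⟨hv, hw⟩).2
      · intro hw
        exact ((key v w).2 ⟨hv, hw⟩).2
  have hmem : ∀ x, x ∈ H ↔ ∃ e ∈ H₁, ∃ f : ∀ v ∈ e, Finset V₂,
      (∀ v h, f v h ∈ H₂) ∧ blowEdge φ e f = x := by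
    intro x
    simp only [hH, hP, mem_image, mem_sigma, mem_pi]
    constructor
    · rintro ⟨⟨e, f⟩, ⟨he, hf⟩, h⟩
      exact ⟨e, he, f, hf, h⟩
    · rintro ⟨e, he, f, hf, h⟩
      exact ⟨⟨e, f⟩, ⟨he, hf⟩, h⟩
  refine ⟨H, critical_of _ _ ?_ ?_ ?_ ?_, hcard⟩
  · intro x hx
    obtain ⟨e, he, f, hf, rfl⟩ := (hmem x).1 hx
    rw [card_blowEdge φ e f r₂ (fun v h => h₂.1 _ (hf v h)), h₁.1 e he]
  · intro x hx y hy
    obtain ⟨e, he, f, hf, rfl⟩ := (hmem x).1 hx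
    obtain ⟨e', he', f', hf', rfl⟩ := (hmem y).1 hy
    obtain ⟨v, hv⟩ := h₁.2.1 e he e' he'
    rw [mem_inter] at hv
    obtain ⟨w, hw⟩ := h₂.2.1 _ (hf v hv.1) _ (hf' v hv.2)
    rw [mem_inter] at hw
    exact ⟨φ (v, w), mem_inter.2 ⟨(mem_blowEdge ..).2 ⟨hv.1, hw.1⟩,
      (mem_blowEdge ..).2 ⟨hv.2, hw.2⟩⟩⟩
  · intro T hT
    let F : V₁ → Finset V₂ := fun v => univ.filter fun w => φ (v, w) ∈ T
    let S : Finset V₁ := univ.filter fun v => ∀ g ∈ H₂, (g ∩ F v).Nonempty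
    have hS : r₁ ≤ S.card := by
      apply h₁.le_cover
      intro e he
      by_contra hcon
      have hx : ∀ v ∈ e, ∃ g ∈ H₂, ¬ (g ∩ F v).Nonempty := by
        intro v hv
        by_contra! hg
        exact hcon ⟨v, by simp [S, hv]; exact hg⟩
      choose f hf hf' using hx
      obtain ⟨x, hx⟩ := hT _ ((hmem _).2 ⟨e, he, f, hf, rfl⟩)
      obtain ⟨⟨v, w⟩, rfl⟩ := φ.surjective x
      rw [mem_inter, mem_blowEdge] at hx
      obtain ⟨⟨hv, hw⟩, hx⟩ := hx
      exact hf' v hv ⟨w, by simp [F, hw, hx]⟩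
    have hF : ∀ v ∈ S, r₂ ≤ (F v).card := by
      intro v hv
      apply h₂.le_cover
      simpa [S] using hv
    calc r₁ * r₂ ≤ S.card * r₂ := Nat.mul_le_mul_right _ hS
      _ ≤ ∑ v ∈ S, (F v).card := by
        simpa using Finset.card_nsmul_le_sum S (fun v => (F v).card) r₂ hF
      _ = (S.sigma F).card := (card_sigma _ _).symm
      _ ≤ T.card := by
        apply card_le_card_of_injOn (fun p => φ (p.1, p.2))
        · rintro ⟨v, w⟩ h
          simp [F] at h
          exact h.2
        · rintro ⟨v, w⟩ _ ⟨v', w'⟩ _ h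
          simp at h
          obtain ⟨rfl, rfl⟩ := h
          rfl
  · intro h
    rw [h, card_empty] at hcard
    rcases Nat.mul_eq_zero.1 hcard.symm with h | h
    · rw [h₁.eq_zero (card_eq_zero.1 h), zero_mul]
    · rw [h₂.eq_zero (card_eq_zero.1 (by by_contra h9; exact (pow_ne_zero _ h9) h)), mul_zero]

theorem stmt_8 {V₁ V₂ : Type*} [Fintype V₁] [Fintype V₂] [DecidableEq V₁] [DecidableEq V₂]
    (r₁ r₂ : ℕ) (H₁ : Finset (Finset V₁)) (H₂ : Finset (Finset V₂))
    (h₁ : Critical r₁ H₁) (h₂ : Critical r₂ H₂) :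
    ∃ H : Finset (Finset (Fin (Fintype.card V₁ * Fintype.card V₂))),
      Critical (r₁ * r₂) H ∧ H.card = H₁.card * H₂.card ^ r₁ := by
  exact blow_main (Fintype.equivFinOfCardEq (Fintype.card_prod V₁ V₂)) r₁ r₂ H₁ H₂ h₁ h₂
end

section
/- If there exists an r-uniform critical hypergraph H, then there exists an (r+1)-uniform critical hypergraph with exactly |V(H)| + r + 1 vertices and at most (r+1)·|E(H)| + 1 edges. -/
open Finset

theorem stmt_9 {V : Type*} [Fintype V] [DecidableEq V]
    (r : ℕ) (H : Finset (Finset V)) (hH : Critical r H) :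
    ∃ H' : Finset (Finset (Fin (Fintype.card V + r + 1))),
      Critical (r + 1) H' ∧ H'.card ≤ (r + 1) * H.card + 1 := by
  obtain ⟨hu, hi, hc⟩ := hH
  have E : V ⊕ Fin (r + 1) ≃ Fin (Fintype.card V + r + 1) :=
    Fintype.equivFinOfCardEq (by simp [add_assoc])
  obtain ⟨a, ha⟩ : ∃ a : V ↪ Fin (Fintype.card V + r + 1), ∀ v, a v = E (Sum.inl v) :=
    ⟨⟨fun v => E (Sum.inl v), fun x y h => by simpa using h⟩, fun _ => rfl⟩
  obtain ⟨b, hb⟩ : ∃ b : Fin (r + 1) ↪ Fin (Fintype.card V + r + 1), ∀ v, b v = E (Sum.inr v) :=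
    ⟨⟨fun v => E (Sum.inr v), fun x y h => by simpa using h⟩, fun _ => rfl⟩
  have hab : ∀ v i, a v ≠ b i := by intro v i h; rw [ha, hb] at h; simp at h
  have hlow : ∀ T : Finset V, (∀ e ∈ H, (e ∩ T).Nonempty) → r ≤ T.card := by
    intro T hT
    rw [← hc]
    exact Nat.sInf_le ⟨T, rfl, hT⟩
  have hX : (univ.map b).card = r + 1 := by simp
  refine ⟨insert (univ.map b)
    ((H ×ˢ (univ : Finset (Fin (r + 1)))).image (fun p => insert (b p.2) (p.1.map a))),
    ⟨?_, ?_, ?_⟩, ?_⟩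
  · intro e he
    rw [mem_insert, mem_image] at he
    rcases he with rfl | ⟨⟨f, i⟩, hf, rfl⟩
    · exact hX
    · rw [card_insert_of_notMem, card_map, hu f (by simpa using hf)]
      simp [hab]
  · intro e he f hf
    rw [mem_insert, mem_image] at he hf
    rcases he with rfl | ⟨⟨e, i⟩, he, rfl⟩ <;> rcases hf with rfl | ⟨⟨f, j⟩, hf, rfl⟩
    · exact ⟨b 0, by simp⟩
    · exact ⟨b j, by simp⟩
    · exact ⟨b i, by simp⟩
    · obtain ⟨v, hv⟩ := hi e (by simpa using he) f (by simpa using hf)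
      rw [mem_inter] at hv
      exact ⟨a v, by simp [hv.1, hv.2]⟩
  · apply le_antisymm
    · apply Nat.sInf_le
      refine ⟨univ.map b, hX, ?_⟩
      intro e he
      rw [mem_insert, mem_image] at he
      rcases he with rfl | ⟨⟨f, i⟩, hf, rfl⟩
      · exact ⟨b 0, by simp⟩
      · exact ⟨b i, by simp⟩
    · apply le_csInf
      · refine ⟨_, univ.map b, rfl, ?_⟩
        intro e he
        rw [mem_insert, mem_image] at he
        rcases he with rfl | ⟨⟨f, i⟩, hf, rfl⟩
        · exact ⟨b 0, by simp⟩
        · exact ⟨b i, by simp⟩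
      · rintro k ⟨T, rfl, hT⟩
        by_cases h : ∀ e ∈ H, (e ∩ univ.filter (fun v => a v ∈ T)).Nonempty
        · have h1 := hlow _ h
          obtain ⟨x, hx⟩ := hT _ (mem_insert_self _ _)
          rw [mem_inter, mem_map] at hx
          obtain ⟨⟨i, -, rfl⟩, hx⟩ := hx
          have h2 : insert (b i) ((univ.filter (fun v => a v ∈ T)).map a) ⊆ T := by
            intro y hy
            rw [mem_insert, mem_map] at hy
            rcases hy with rfl | ⟨v, hv, rfl⟩
            · exact hx
            · simpa using hv
          have h3 := card_le_card h2
          rw [card_insert_of_notMem (by simp [hab]), card_map] at h3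
          omega
        · push Not at h
          obtain ⟨e, he, h⟩ := h
          rw [← hX]
          apply card_le_card
          intro y hy
          obtain ⟨i, -, rfl⟩ := mem_map.1 hy
          obtain ⟨x, hx⟩ := hT (insert (b i) (e.map a))
            (mem_insert_of_mem (mem_image.2 ⟨(e, i), by simp [he], rfl⟩))
          rw [mem_inter, mem_insert, mem_map] at hx
          obtain ⟨rfl | ⟨v, hv, rfl⟩, hx⟩ := hx
          · exact hx
          · exfalso
            have : v ∈ e ∩ univ.filter (fun v => a v ∈ T) := by simp [hv, hx]
            rw [h] at this
            simp at this
  · refine (card_insert_le _ _).trans ?_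
    have := card_image_le (s := H ×ˢ (univ : Finset (Fin (r + 1))))
      (f := fun p => insert (b p.2) (p.1.map a))
    rw [card_product, card_univ, Fintype.card_fin, mul_comm] at this
    omega
end

section
/- Let r and n be integers with 2r−1 ≤ n < r², and let H be an n-vertex r-uniform hypergraph with cover number at least r. Then |E(H)| > (n/(5r)) · C(n, r−1)/C(n−r, r−1), where C(a,b) denotes the binomial coefficient. -/
open Finset

lemma count_aux {V : Type} [Fintype V] [DecidableEq V] (n r s : ℕ) (hV : Fintype.card V = n)
    (H : Finset (Finset V)) (hunif : ∀ e ∈ H, e.card = r) (hcov : r ≤ coverNumber H)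
    (hs : s < r) (hn : 0 < n) : (r - s) * n.choose s ≤ H.card * (n - r).choose s := by
  classical
  have key := Finset.sum_card_bipartiteAbove_eq_sum_card_bipartiteBelow
    (s := Finset.powersetCard s (Finset.univ : Finset V)) (t := H) (fun S e => Disjoint S e)
  have hL : (r - s) * n.choose s ≤ ∑ S ∈ Finset.powersetCard s (Finset.univ : Finset V),
      (H.bipartiteAbove (fun S e => Disjoint S e) S).card := by
    have := Finset.card_nsmul_le_sum (Finset.powersetCard s (Finset.univ : Finset V))
      (fun S => (H.bipartiteAbove (fun S e => Disjoint S e) S).card) (r - s) ?_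
    · rw [Finset.card_powersetCard, Finset.card_univ, hV, smul_eq_mul] at this
      rw [mul_comm]; exact this
    · intro S hS
      rw [Finset.mem_powersetCard] at hS
      by_contra hlt
      push Not at hlt
      have hne : ∀ e ∈ H, e.Nonempty := fun e he => by
        rw [← Finset.card_pos, hunif e he]; omega
      have : Nonempty V := Fintype.card_pos_iff.1 (by omega)
      choose! f hf using hne
      set F := H.bipartiteAbove (fun S e => Disjoint S e) S with hF
      have hT : (S ∪ F.image f).card < r := by
        have a1 := Finset.card_union_le S (F.image f)
        have a2 : (F.image f).card ≤ F.card := Finset.card_image_le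
        omega
      have : coverNumber H ≤ (S ∪ F.image f).card := by
        apply Nat.sInf_le
        refine ⟨_, rfl, fun e he => ?_⟩
        by_cases hd : Disjoint S e
        · refine ⟨f e, Finset.mem_inter.2 ⟨hf e he, Finset.mem_union_right _ ?_⟩⟩
          apply Finset.mem_image_of_mem
          rw [hF, Finset.mem_bipartiteAbove]
          exact ⟨he, hd⟩
        · rw [Finset.not_disjoint_iff] at hd
          obtain ⟨x, hx, hx'⟩ := hd
          exact ⟨x, Finset.mem_inter.2 ⟨hx', Finset.mem_union_left _ hx⟩⟩
      omega
  have hR : ∑ e ∈ H, ((Finset.powersetCard s (Finset.univ : Finset V)).bipartiteBelow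
      (fun S e => Disjoint S e) e).card ≤ H.card * (n - r).choose s := by
    rw [← smul_eq_mul]
    apply Finset.sum_le_card_nsmul
    intro e he
    have hc : (eᶜ).card = n - r := by rw [Finset.card_compl, hV, hunif e he]
    rw [← hc, ← Finset.card_powersetCard]
    apply Finset.card_le_card
    intro S hS
    rw [Finset.mem_bipartiteBelow, Finset.mem_powersetCard] at hS
    rw [Finset.mem_powersetCard]
    refine ⟨fun x hx => ?_, hS.1.2⟩
    rw [Finset.mem_compl]
    exact Finset.disjoint_left.1 hS.2 hx
  omega

lemma ratio_aux (n r s k : ℕ) (h1 : 2 * r - 1 ≤ n) (hr : 2 ≤ r) (hs : s + k ≤ r - 1) :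
    (n.choose (s + k) : ℝ) / ((n - r).choose (s + k) : ℝ) ≤
      (n.choose s : ℝ) / ((n - r).choose s : ℝ) *
        (1 + (r : ℝ) / ((n : ℝ) - 2 * r + 2)) ^ k := by
  induction k with
  | zero => simp
  | succ k ih =>
    have ih := ih (by omega)
    obtain ⟨m, rfl⟩ : ∃ m, n = 2 * r - 1 + m := ⟨n - (2 * r - 1), by omega⟩
    obtain ⟨d, rfl⟩ : ∃ d, r = s + k + 2 + d := ⟨r - (s + k + 2), by omega⟩
    set j := s + k with hj
    have e1 : 2 * (j + 2 + d) - 1 + m = 2 * j + 3 + 2 * d + m := by omega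
    have e2 : 2 * j + 3 + 2 * d + m - (j + 2 + d) = j + 1 + d + m := by omega
    simp only [e1, e2] at ih ⊢
    have p1 := Nat.choose_succ_right_eq (2 * j + 3 + 2 * d + m) j
    have p2 := Nat.choose_succ_right_eq (j + 1 + d + m) j
    rw [show 2 * j + 3 + 2 * d + m - j = j + 3 + 2 * d + m by omega] at p1
    rw [show j + 1 + d + m - j = 1 + d + m by omega] at p2
    have q1 : (((2 * j + 3 + 2 * d + m).choose (j+1) : ℕ) : ℝ) * (j + 1) =
      ((2 * j + 3 + 2 * d + m).choose j : ℕ) * (j + 3 + 2 * d + m) := by exact_mod_cast p1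
    have q2 : (((j + 1 + d + m).choose (j+1) : ℕ) : ℝ) * (j + 1) =
      ((j + 1 + d + m).choose j : ℕ) * (1 + d + m) := by exact_mod_cast p2
    have pos1 : (0 : ℝ) < ((j + 1 + d + m).choose j : ℕ) := by
      exact_mod_cast Nat.choose_pos (by omega)
    have pos2 : (0 : ℝ) < ((j + 1 + d + m).choose (j + 1) : ℕ) := by
      exact_mod_cast Nat.choose_pos (by omega)
    have step : (((2 * j + 3 + 2 * d + m).choose (j+1) : ℕ) : ℝ) / ((j + 1 + d + m).choose (j+1) : ℕ)
       = (((2 * j + 3 + 2 * d + m).choose j : ℕ) : ℝ) / ((j + 1 + d + m).choose j : ℕ) *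
        ((j + 3 + 2 * d + m) / (1 + d + m)) := by
      have hj1 : (0 : ℝ) < (j : ℝ) + 1 := by positivity
      rw [← mul_div_mul_right _ _ hj1.ne', q1, q2, mul_div_mul_comm]
    rw [show s + (k + 1) = j + 1 by omega, step, pow_succ, ← mul_assoc]
    have hq : ((j : ℝ) + 3 + 2 * d + m) / (1 + d + m) ≤
        1 + ((j + 2 + d : ℕ) : ℝ) / (((2 * j + 3 + 2 * d + m : ℕ) : ℝ) - 2 * (j + 2 + d : ℕ) + 2) := by
      push_cast
      have : (2 * (j : ℝ) + 3 + 2 * d + m - 2 * (j + 2 + d) + 2) = m + 1 := by ring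
      rw [this, show ((j : ℝ) + 3 + 2 * d + m) = (1 + d + m) + (j + 2 + d) by ring, add_div,
        div_self (by positivity)]
      have hd : (0 : ℝ) ≤ d := by positivity
      have hm : (m : ℝ) + 1 ≤ 1 + d + m := by linarith
      have := div_le_div_of_nonneg_left (show (0 : ℝ) ≤ (j : ℝ) + 2 + d by positivity)
        (show (0 : ℝ) < (m : ℝ) + 1 by positivity) hm
      linarith
    apply mul_le_mul ih hq (by positivity)
    exact le_trans (by positivity) ih

theorem stmt_10 (n r : ℕ) (h1 : 2 * r - 1 ≤ n) (h2 : n < r ^ 2)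
    (V : Type) [Fintype V] [DecidableEq V] (hV : Fintype.card V = n)
    (H : Finset (Finset V))
    (hunif : ∀ e ∈ H, e.card = r)
    (hcov : r ≤ coverNumber H) :
    ((n : ℝ) / (5 * (r : ℝ))) * ((n.choose (r - 1) : ℝ) / ((n - r).choose (r - 1) : ℝ)) <
      (H.card : ℝ) := by
  have hr : 2 ≤ r := by
    by_contra h
    have : r = 0 ∨ r = 1 := by omega
    rcases this with rfl | rfl <;> omega
  have hrR : (2 : ℝ) ≤ r := by exact_mod_cast hr
  have base : ∀ s, s < r → ((r - s : ℕ) : ℝ) * ((n.choose s : ℝ) / ((n - r).choose s : ℝ)) ≤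
      (H.card : ℝ) := by
    intro s hs
    have h := count_aux n r s hV H hunif hcov hs (by omega)
    have pos : (0 : ℝ) < ((n - r).choose s : ℝ) := by
      exact_mod_cast Nat.choose_pos (by omega)
    rw [← mul_div_assoc, div_le_iff₀ pos]
    exact_mod_cast h
  have Rpos : (0 : ℝ) < (n.choose (r - 1) : ℝ) / ((n - r).choose (r - 1) : ℝ) := by
    apply div_pos
    · exact_mod_cast Nat.choose_pos (by omega)
    · exact_mod_cast Nat.choose_pos (by omega)
  by_cases hn : n < 5 * r
  · have h := base (r - 1) (by omega)
    rw [show r - (r - 1) = 1 by omega, Nat.cast_one] at h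
    refine lt_of_lt_of_le ?_ h
    apply mul_lt_mul_of_pos_right _ Rpos
    rw [div_lt_one (by positivity)]
    exact_mod_cast hn
  · push Not at hn
    obtain ⟨w, hw⟩ : ∃ w, n + 2 = w + 2 * r := ⟨n + 2 - 2 * r, by omega⟩
    set k := w / r with hk
    have hk1 : k * r ≤ w := Nat.div_mul_le_self w r
    have hk2 : w < (k + 1) * r := by
      have := Nat.lt_div_mul_add (a := w) (b := r) (by omega)
      rw [← hk] at this
      linarith
    have hk3 : k ≤ r - 1 := by
      have : k < r := by
        rw [hk, Nat.div_lt_iff_lt_mul (by omega)]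
        nlinarith
      omega
    clear_value k
    clear hk
    obtain ⟨s, hs⟩ : ∃ s, s + k = r - 1 := ⟨r - 1 - k, by omega⟩
    have hb := base s (by omega)
    have hrat := ratio_aux n r s k h1 hr hs.le
    rw [hs] at hrat
    rw [show r - s = k + 1 by omega] at hb
    have hwR : (n : ℝ) - 2 * r + 2 = w := by
      have : (n : ℝ) + 2 = w + 2 * r := by exact_mod_cast hw
      linarith
    have hwpos : (0 : ℝ) < w := by
      have : 0 < w := by omega
      exact_mod_cast this
    rw [hwR] at hrat
    have hexp : (1 + (r : ℝ) / w) ^ k ≤ Real.exp 1 := by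
      calc (1 + (r : ℝ) / w) ^ k ≤ (Real.exp (r / w)) ^ k := by
            apply pow_le_pow_left₀ (by positivity)
            have := Real.add_one_le_exp ((r : ℝ) / w)
            linarith
        _ = Real.exp (k * (r / w)) := by rw [← Real.exp_nat_mul]
        _ ≤ Real.exp 1 := by
            apply Real.exp_le_exp.2
            rw [← mul_div_assoc, div_le_one hwpos]
            exact_mod_cast hk1
    have he := Real.exp_one_lt_d9
    set R := (n.choose (r - 1) : ℝ) / ((n - r).choose (r - 1) : ℝ) with hR
    set Q := (n.choose s : ℝ) / ((n - r).choose s : ℝ) with hQ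
    have hQ0 : 0 ≤ Q := by positivity
    have hQR : R ≤ Q * 3 := hrat.trans (by gcongr; linarith)
    have hQR' : R ≤ Q * 2.72 := hrat.trans (by gcongr; linarith)
    have hQpos : 0 < Q := by linarith
    have hnR : 5 * (r : ℝ) ≤ n := by exact_mod_cast hn
    have hk2R : (w : ℝ) < (k + 1) * r := by exact_mod_cast hk2
    refine lt_of_lt_of_le ?_ hb
    push_cast
    calc (n : ℝ) / (5 * r) * R ≤ (n : ℝ) / (5 * r) * (Q * 2.72) := by gcongr
      _ = ((n : ℝ) / (5 * r) * 2.72) * Q := by ring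
      _ < (k + 1) * Q := by
        apply mul_lt_mul_of_pos_right _ hQpos
        rw [div_mul_eq_mul_div, div_lt_iff₀ (by positivity)]
        nlinarith
end

section
/- For all integers n ≥ 2r−1 ≥ 3, there exists an n-vertex r-uniform hypergraph H with cover number at least r (equivalently, with the property that every set of n−r+1 vertices contains an edge) such that |E(H)| ≤ (C(n,r)/C(n−r+1,r)) · ln C(n,r−1) + 1, where C(a,b) denotes the binomial coefficient and ln is the natural logarithm. -/
open Finset

/-- Greedy step: some `r`-set is disjoint from at least the average number of members of `U`. -/
lemma greedy_step (n r : ℕ) (hr : 1 ≤ r) (hn : r ≤ n)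
    (U : Finset (Finset (Fin n))) (hU : ∀ T ∈ U, T.card = r - 1) :
    ∃ e : Finset (Fin n), e.card = r ∧
      U.card * (n - r + 1).choose r ≤ n.choose r * (U.filter (fun T => Disjoint e T)).card := by
  classical
  by_contra! hcon
  have hne : (powersetCard r (univ : Finset (Fin n))).Nonempty := by
    rw [powersetCard_nonempty]; simpa using hn
  have h1 : ∑ e ∈ powersetCard r (univ : Finset (Fin n)),
      (U.filter (fun T => Disjoint e T)).card = U.card * (n - r + 1).choose r := by
    simp only [card_filter]
    rw [sum_comm]
    rw [← smul_eq_mul, ← sum_const]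
    refine sum_congr rfl fun T hT => ?_
    rw [← card_filter]
    have : (powersetCard r (univ : Finset (Fin n))).filter (fun e => Disjoint e T)
        = powersetCard r (Tᶜ) := by
      ext e
      simp only [mem_filter, mem_powersetCard, subset_univ, true_and]
      rw [subset_compl_iff_disjoint_right]
      tauto
    rw [this, card_powersetCard, card_compl, hU T hT, Fintype.card_fin]
    congr 1
    omega
  have h2 : ∑ e ∈ powersetCard r (univ : Finset (Fin n)),
      n.choose r * (U.filter (fun T => Disjoint e T)).card
      < ∑ e ∈ powersetCard r (univ : Finset (Fin n)), U.card * (n - r + 1).choose r :=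
    sum_lt_sum_of_nonempty hne fun e he => hcon e (mem_powersetCard.1 he).2
  rw [← mul_sum, h1, sum_const, card_powersetCard, card_univ, Fintype.card_fin, smul_eq_mul] at h2
  exact lt_irrefl _ h2

lemma greedy_iter (n r : ℕ) (hr : 1 ≤ r) (hn : r ≤ n) (t : ℕ) :
    ∃ H : Finset (Finset (Fin n)), (∀ e ∈ H, e.card = r) ∧ H.card ≤ t ∧
      (((powersetCard (r - 1) (univ : Finset (Fin n))).filter
        (fun T => ∀ e ∈ H, ¬ Disjoint e T)).card : ℝ) ≤
      (n.choose (r - 1) : ℝ) *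
        Real.exp (-(((n - r + 1).choose r : ℝ) / (n.choose r : ℝ)) * t) := by
  classical
  induction t with
  | zero => exact ⟨∅, by simp, by simp, by simp⟩
  | succ t ih =>
    obtain ⟨H, hH, hc, hb⟩ := ih
    set U := (powersetCard (r - 1) (univ : Finset (Fin n))).filter
        (fun T => ∀ e ∈ H, ¬ Disjoint e T) with hUdef
    obtain ⟨e, he, hge⟩ := greedy_step n r hr hn U (fun T hT => by
      rw [hUdef, mem_filter, mem_powersetCard] at hT; exact hT.1.2)
    refine ⟨insert e H, ?_, (card_insert_le _ _).trans (by omega), ?_⟩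
    · intro f hf
      rcases mem_insert.1 hf with rfl | hf
      · exact he
      · exact hH f hf
    have heq : (powersetCard (r - 1) (univ : Finset (Fin n))).filter
        (fun T => ∀ f ∈ insert e H, ¬ Disjoint f T) = U.filter (fun T => ¬ Disjoint e T) := by
      ext T
      simp only [hUdef, mem_filter, forall_mem_insert]
      tauto
    rw [heq]
    have hsum := card_filter_add_card_filter_not (s := U) (fun T => Disjoint e T)
    have hsum' : ((U.filter (fun T => Disjoint e T)).card : ℝ)
        + ((U.filter (fun T => ¬ Disjoint e T)).card : ℝ) = U.card := by exact_mod_cast hsum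
    have hge' : (U.card : ℝ) * ((n - r + 1).choose r : ℝ)
        ≤ (n.choose r : ℝ) * ((U.filter (fun T => Disjoint e T)).card : ℝ) := by
      exact_mod_cast hge
    have hpos : (0 : ℝ) < n.choose r := by exact_mod_cast Nat.choose_pos hn
    set p : ℝ := ((n - r + 1).choose r : ℝ) / (n.choose r : ℝ) with hp
    have h3 : (U.card : ℝ) * p ≤ ((U.filter (fun T => Disjoint e T)).card : ℝ) := by
      rw [hp, ← mul_div_assoc, div_le_iff₀ hpos]; linarith
    have h4 : 1 - p ≤ Real.exp (-p) := by
      have := Real.add_one_le_exp (-p); linarith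
    calc ((U.filter (fun T => ¬ Disjoint e T)).card : ℝ) ≤ U.card * (1 - p) := by linarith
      _ ≤ U.card * Real.exp (-p) := by gcongr
      _ ≤ ((n.choose (r - 1) : ℝ) * Real.exp (-p * t)) * Real.exp (-p) := by gcongr
      _ = _ := by
        rw [mul_assoc, ← Real.exp_add]; congr 2; push_cast; ring

theorem stmt_16 (n r : ℕ) (h3 : 3 ≤ 2 * r - 1) (hn : 2 * r - 1 ≤ n) :
    ∃ H : Finset (Finset (Fin n)),
      (∀ e ∈ H, e.card = r) ∧
      r ≤ coverNumber H ∧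
      (H.card : ℝ) ≤
        ((n.choose r : ℝ) / ((n - r + 1).choose r : ℝ)) * Real.log (n.choose (r - 1)) + 1 := by
  classical
  have hA : (0 : ℝ) < n.choose r := by exact_mod_cast Nat.choose_pos (by omega)
  have hB : (0 : ℝ) < (n - r + 1).choose r := by exact_mod_cast Nat.choose_pos (by omega)
  have hN : 0 < n.choose (r - 1) := Nat.choose_pos (by omega)
  have hN' : (0 : ℝ) < n.choose (r - 1) := by exact_mod_cast hN
  have hlog : 0 ≤ Real.log (n.choose (r - 1)) := Real.log_nonneg (by exact_mod_cast hN)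
  set L := Real.log (n.choose (r - 1)) with hL
  set x : ℝ := ((n.choose r : ℝ) / ((n - r + 1).choose r : ℝ)) * L with hx
  have hx0 : 0 ≤ x := by positivity
  obtain ⟨H, hH, hc, hb⟩ := greedy_iter n r (by omega) (by omega) (⌊x⌋₊ + 1)
  refine ⟨H, hH, ?_, ?_⟩
  · have hlt : x < ((⌊x⌋₊ + 1 : ℕ) : ℝ) := by push_cast; exact Nat.lt_floor_add_one x
    have hzero : ((powersetCard (r - 1) (univ : Finset (Fin n))).filter
        (fun T => ∀ e ∈ H, ¬ Disjoint e T)).card = 0 := by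
      have : (((powersetCard (r - 1) (univ : Finset (Fin n))).filter
        (fun T => ∀ e ∈ H, ¬ Disjoint e T)).card : ℝ) < 1 := by
        refine hb.trans_lt ?_
        have hLx : L = (((n - r + 1).choose r : ℝ) / (n.choose r : ℝ)) * x := by
          rw [hx]; field_simp
        have hlt2 := mul_lt_mul_of_pos_left hlt (div_pos hB hA)
        rw [← hLx] at hlt2
        calc _ = Real.exp L * Real.exp (-(((n - r + 1).choose r : ℝ) / (n.choose r : ℝ))
                * ((⌊x⌋₊ + 1 : ℕ) : ℝ)) := by rw [hL, Real.exp_log hN']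
          _ < 1 := by
            rw [← Real.exp_add, Real.exp_lt_one_iff]
            linarith
      have h1 : ((powersetCard (r - 1) (univ : Finset (Fin n))).filter
        (fun T => ∀ e ∈ H, ¬ Disjoint e T)).card < 1 := by exact_mod_cast this
      omega
    unfold coverNumber
    refine le_csInf ⟨_, univ, rfl, fun e he => ?_⟩ ?_
    · rw [inter_univ, ← card_pos, hH e he]; omega
    · rintro k ⟨T, rfl, hT⟩
      by_contra! hk
      obtain ⟨T', hTT', hT'⟩ := exists_superset_card_eq (s := T) (n := r - 1) (by omega)
        (by rw [Fintype.card_fin]; omega)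
      rw [card_eq_zero] at hzero
      have : T' ∈ (powersetCard (r - 1) (univ : Finset (Fin n))).filter
        (fun T => ∀ e ∈ H, ¬ Disjoint e T) := by
        rw [mem_filter, mem_powersetCard]
        refine ⟨⟨subset_univ _, hT'⟩, fun e he hd => ?_⟩
        have h5 := hT e he
        rw [← not_disjoint_iff_nonempty_inter] at h5
        exact h5 (disjoint_of_subset_right hTT' hd)
      rw [hzero] at this
      simp at this
  · have h6 : (H.card : ℝ) ≤ ((⌊x⌋₊ + 1 : ℕ) : ℝ) := by exact_mod_cast hc
    have h7 := Nat.floor_le hx0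
    push_cast at h6
    linarith
end
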